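/- arXiv:2104.14706 — 2 statements merged into one kernel-verified Lean document; each statement's English description precedes it below -/
import Mathlib

section
/- Let ρ0 and ρ1 be quantum states on ℂ^d with full support. Then the supremum of D(P_{ρ0,m}‖P_{ρ1,m}) over all finite outcome sets 𝒳 and all POVMs m with outcome set 𝒳 equals the measured relative entropy D_M(ρ0‖ρ1), and this supremum is attained by some PVM with exactly d outcomes. -/
open scoped ENNReal NNReal ComplexOrder

namespace SQHT

/-- `d × d` complex matrices over an index type `ι`. -/
abbrev Mat (ι : Type) := Matrix ι ι ℂ

variable {ι : Type} [Fintype ι] [DecidableEq ι]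

/-- A quantum state: positive semidefinite with unit trace. -/
def IsState (ρ : Mat ι) : Prop := ρ.PosSemidef ∧ ρ.trace = 1

/-- A POVM with finite outcome set `Fin N`. -/
def IsPOVM {N : ℕ} (m : Fin N → Mat ι) : Prop :=
  (∀ x, (m x).PosSemidef) ∧ ∑ x, m x = 1

/-- A PVM: a POVM all of whose elements are (orthogonal) projections. -/
def IsPVM {N : ℕ} (m : Fin N → Mat ι) : Prop :=
  IsPOVM m ∧ ∀ x, m x * m x = m x

/-- Born probability of outcome `x` when measuring `m` on state `ρ`. -/
noncomputable def outProb (ρ : Mat ι) {X : Type*} (m : X → Mat ι) (x : X) : ℝ :=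
  ((ρ * m x).trace).re

/-- Classical relative entropy (KL divergence) of two pmfs on a finite set,
with the convention `0 log 0 = 0`. -/
noncomputable def KL {X : Type*} [Fintype X] (P Q : X → ℝ) : ℝ :=
  ∑ x, if P x = 0 then 0 else P x * Real.log (P x / Q x)

/-- A rank-one projective measurement with `|ι|` outcomes. -/
def IsRankOnePVM (m : ι → Mat ι) : Prop :=
  (∀ x, (m x).PosSemidef) ∧ ∑ x, m x = 1 ∧ (∀ x, m x * m x = m x) ∧ ∀ x, (m x).rank = 1

/-- The measured relative entropy `D_M(ρ0‖ρ1)`: supremum of classical relative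
entropies over rank-one PVMs with `|ι|` outcomes. -/
noncomputable def Dmeas (ρ0 ρ1 : Mat ι) : ℝ :=
  ⨆ m : {m : ι → Mat ι // IsRankOnePVM m}, KL (outProb ρ0 m.1) (outProb ρ1 m.1)

/-- The real-linear functional `M ↦ Re Tr(ρ M)`, whose values on a POVM are the outcome
probabilities. -/
noncomputable def expVal (ρ : Mat ι) : Mat ι →ₗ[ℝ] ℝ where
  toFun M := ((ρ * M).trace).re
  map_add' M M' := by simp [Matrix.mul_add]
  map_smul' c M := by simp

theorem outProb_eq_expVal (ρ : Mat ι) {X : Type*} (m : X → Mat ι) (x : X) :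
    outProb ρ m x = expVal ρ (m x) := rfl

open scoped MatrixOrder in
theorem exists_conjTranspose_mul_self {A : Mat ι} (hA : A.PosSemidef) :
    ∃ B : Mat ι, A = B.conjTranspose * B :=
  CStarAlgebra.nonneg_iff_eq_star_mul_self.mp hA.nonneg

theorem expVal_nonneg {ρ M : Mat ι} (hρ : ρ.PosSemidef) (hM : M.PosSemidef) :
    0 ≤ expVal ρ M := by
  obtain ⟨C, rfl⟩ := exists_conjTranspose_mul_self hM
  have h := (hρ.mul_mul_conjTranspose_same C).trace_nonneg
  rw [Matrix.trace_mul_comm, ← Matrix.mul_assoc, Matrix.trace_mul_comm] at h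
  exact (Complex.le_def.mp h).1

theorem eq_zero_of_expVal_eq_zero {ρ M : Mat ι} (hρ : ρ.PosDef) (hM : M.PosSemidef)
    (h0 : expVal ρ M = 0) : M = 0 := by
  obtain ⟨C, rfl⟩ := exists_conjTranspose_mul_self hM
  have hP := hρ.posSemidef.mul_mul_conjTranspose_same C
  have ht : (C * ρ * C.conjTranspose).trace = 0 := by
    have h := hP.trace_nonneg
    refine Complex.ext ?_ (Complex.le_def.mp h).2.symm
    rw [Matrix.trace_mul_comm, ← Matrix.mul_assoc, Matrix.trace_mul_comm]
    exact h0
  rw [hP.trace_eq_zero_iff] at ht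
  obtain ⟨R, hR⟩ := exists_conjTranspose_mul_self hρ.posSemidef
  have hunit : IsUnit (R.conjTranspose * R) := hR ▸ hρ.isUnit
  have hCR : C * R.conjTranspose = 0 := by
    rw [← Matrix.self_mul_conjTranspose_eq_zero, Matrix.conjTranspose_mul,
      Matrix.conjTranspose_conjTranspose, ← ht, hR]
    simp only [Matrix.mul_assoc]
  have hC : C = 0 := by
    rw [← hunit.mul_left_eq_zero, ← Matrix.mul_assoc, hCR, Matrix.zero_mul]
  simp [hC]

theorem expVal_pos {ρ M : Mat ι} (hρ : ρ.PosDef) (hM : M.PosSemidef) (hM0 : M ≠ 0) :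
    0 < expVal ρ M :=
  (expVal_nonneg hρ.posSemidef hM).lt_of_ne fun h ↦ hM0 (eq_zero_of_expVal_eq_zero hρ hM h.symm)

/-- If `∑ w i • E i = ∑ a x • m x` for a projective measurement `E` and a POVM `m`, then
`(∑ a x • m x)⁻¹ ≤ ∑ (a x)⁻¹ • m x` in expectation. -/
theorem sum_inv_mul_expVal_le {κ X : Type*} [Fintype κ] [DecidableEq κ] [Fintype X]
    {ρ : Mat ι} (hρ : ρ.PosSemidef)
    {m : X → Mat ι} (hm : ∀ x, (m x).PosSemidef) (hm1 : ∑ x, m x = 1)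
    {E : κ → Mat ι} (hE : ∀ i, (E i).PosSemidef) (hE1 : ∑ i, E i = 1)
    (hEE : ∀ i j, E i * E j = if i = j then E i else 0)
    {w : κ → ℝ} (hw : ∀ i, 0 < w i) {a : X → ℝ} (ha : ∀ x, 0 < a x)
    (hwa : ∑ i, w i • E i = ∑ x, a x • m x) :
    ∑ i, (w i)⁻¹ * expVal ρ (E i) ≤ ∑ x, (a x)⁻¹ * expVal ρ (m x) := by
  set B : Mat ι := ∑ i, (w i)⁻¹ • E i with hB
  have hBherm : B.conjTranspose = B := by
    simp [hB, Matrix.conjTranspose_sum, fun i ↦ (hE i).isHermitian.eq]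
  have hBA : B * ∑ x, a x • m x = 1 := by
    rw [← hwa, hB, ← hE1, Finset.sum_mul]
    refine Finset.sum_congr rfl fun i _ ↦ ?_
    simp [Finset.mul_sum, hEE, smul_smul, (hw i).ne']
  have hm1' : ∑ x, B * m x = B := by rw [← Finset.mul_sum, hm1, Matrix.mul_one]
  have hm1'' : ∑ x, m x * B = B := by rw [← Finset.sum_mul, hm1, Matrix.one_mul]
  have hsum : ∑ x, a x • ((B - (a x)⁻¹ • 1) * m x * (B - (a x)⁻¹ • 1).conjTranspose) =
      ∑ x, (a x)⁻¹ • m x - B := by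
    have hterm : ∀ x, a x • ((B - (a x)⁻¹ • 1) * m x * (B - (a x)⁻¹ • 1).conjTranspose) =
        B * (a x • m x) * B - B * m x - m x * B + (a x)⁻¹ • m x := fun x ↦ by
      have hx := (ha x).ne'
      simp only [Matrix.conjTranspose_sub, hBherm, Matrix.conjTranspose_smul,
        Matrix.conjTranspose_one, star_trivial, Matrix.sub_mul, Matrix.mul_sub, smul_sub,
        Matrix.smul_mul, Matrix.mul_smul, Matrix.one_mul, Matrix.mul_one, smul_smul,
        mul_inv_cancel₀ hx, mul_inv_cancel_left₀ hx, one_smul]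
      abel
    simp only [hterm, Finset.sum_add_distrib, Finset.sum_sub_distrib, hm1', hm1'']
    rw [← Finset.sum_mul, ← Finset.mul_sum, hBA, Matrix.one_mul]
    abel
  have hnonneg : 0 ≤ expVal ρ (∑ x, (a x)⁻¹ • m x - B) := by
    rw [← hsum, map_sum]
    refine Finset.sum_nonneg fun x _ ↦ ?_
    rw [map_smul]
    exact mul_nonneg (ha x).le (expVal_nonneg hρ ((hm x).mul_mul_conjTranspose_same _))
  simpa [hB] using hnonneg

/-- The logarithm is an integrated resolvent: if the weighted resolvents of two positive point
configurations of equal total mass are ordered, so are the weighted logarithms, in reverse. -/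
theorem sum_mul_log_le_of_sum_inv_le {κ X : Type*} [Fintype κ] [Fintype X]
    {c w : κ → ℝ} {b a : X → ℝ} (hw : ∀ i, 0 < w i) (ha : ∀ x, 0 < a x)
    (hcb : ∑ i, c i = ∑ x, b x)
    (h : ∀ t : ℝ, 0 ≤ t → ∑ i, (w i + t)⁻¹ * c i ≤ ∑ x, (a x + t)⁻¹ * b x) :
    ∑ x, b x * Real.log (a x) ≤ ∑ i, c i * Real.log (w i) := by
  let g : ℝ → ℝ := fun t ↦ ∑ i, c i * Real.log (w i + t) - ∑ x, b x * Real.log (a x + t)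
  have hderiv : ∀ t : ℝ, 0 ≤ t →
      HasDerivAt g (∑ i, (w i + t)⁻¹ * c i - ∑ x, (a x + t)⁻¹ * b x) t := by
    intro t ht
    have hlog : ∀ u : ℝ, 0 < u → ∀ k : ℝ,
        HasDerivAt (fun s ↦ k * Real.log (u + s)) ((u + t)⁻¹ * k) t := by
      intro u hu k
      have h := ((((hasDerivAt_id t).const_add u).log (by simp; positivity)).const_mul k)
      convert! h using 1
      simp
      ring
    exact (HasDerivAt.fun_sum fun i _ ↦ hlog (w i) (hw i) (c i)).sub
      (HasDerivAt.fun_sum fun x _ ↦ hlog (a x) (ha x) (b x))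
  have hanti : AntitoneOn g (Set.Ici 0) := by
    refine antitoneOn_of_deriv_nonpos (convex_Ici 0)
      (fun t ht ↦ (hderiv t ht).continuousAt.continuousWithinAt)
      (fun t ht ↦ (hderiv t (interior_subset ht)).differentiableAt.differentiableWithinAt)
      fun t ht ↦ ?_
    rw [(hderiv t (interior_subset ht)).deriv]
    exact sub_nonpos.mpr (h t (interior_subset ht))
  have hlim : Filter.Tendsto g Filter.atTop (nhds 0) := by
    have hterm : ∀ u k : ℝ, Filter.Tendsto (fun t ↦ k * (Real.log (t + u) - Real.log t))
        Filter.atTop (nhds 0) := fun u k ↦ by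
      simpa using (Real.tendsto_log_comp_add_sub_log u).const_mul k
    have h := (tendsto_finsetSum Finset.univ fun i _ ↦ hterm (w i) (c i)).sub
      (tendsto_finsetSum Finset.univ fun x _ ↦ hterm (a x) (b x))
    simp only [Finset.sum_const_zero, sub_zero] at h
    refine h.congr fun t ↦ ?_
    simp only [g, mul_sub, Finset.sum_sub_distrib, ← Finset.sum_mul, hcb, add_comm t]
    ring
  have h0 : 0 ≤ g 0 := le_of_tendsto' (hlim.comp tendsto_natCast_atTop_atTop) fun n : ℕ ↦
    hanti Set.self_mem_Ici (Set.mem_Ici.mpr n.cast_nonneg) n.cast_nonneg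
  simpa [g] using h0

/-- The rank-one projection onto the `i`-th column of `U`. -/
def colProj (U : Mat ι) (i : ι) : Mat ι := U * Matrix.single i i 1 * star U

theorem sum_smul_colProj (U : Mat ι) (f : ι → ℝ) :
    ∑ i, f i • colProj U i = U * Matrix.diagonal (fun i ↦ (f i : ℂ)) * star U := by
  have h : Matrix.diagonal (fun i ↦ (f i : ℂ)) = ∑ i, f i • Matrix.single i i (1 : ℂ) := by
    rw [← Matrix.sum_single_eq_diagonal]
    simp [Matrix.smul_single]
  rw [h, Finset.mul_sum, Finset.sum_mul]
  simp only [colProj, Matrix.mul_smul, Matrix.smul_mul]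

theorem colProj_posSemidef (U : Mat ι) (i : ι) : (colProj U i).PosSemidef := by
  refine Matrix.PosSemidef.mul_mul_conjTranspose_same ?_ U
  rw [← Matrix.diagonal_single]
  refine Matrix.PosSemidef.diagonal fun j ↦ ?_
  by_cases h : j = i
  · subst h; simp
  · simp [h]

theorem sum_colProj {U : Mat ι} (hU : U ∈ Matrix.unitaryGroup ι ℂ) : ∑ i, colProj U i = 1 := by
  have h := sum_smul_colProj U fun _ ↦ 1
  simpa [Matrix.mem_unitaryGroup_iff.mp hU] using h

theorem colProj_mul {U : Mat ι} (hU : U ∈ Matrix.unitaryGroup ι ℂ) (i j : ι) :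
    colProj U i * colProj U j = if i = j then colProj U i else 0 := by
  have h : colProj U i * colProj U j =
      U * (Matrix.single i i 1 * (star U * U) * Matrix.single j j 1) * star U := by
    simp only [colProj, Matrix.mul_assoc]
  rw [h, Matrix.mem_unitaryGroup_iff'.mp hU, Matrix.mul_one]
  split_ifs with hij
  · subst hij; simp [colProj]
  · simp [Matrix.single_mul_single_of_ne, hij]

theorem isRankOnePVM_colProj {U : Mat ι} (hU : U ∈ Matrix.unitaryGroup ι ℂ) :
    IsRankOnePVM (colProj U) := by
  refine ⟨colProj_posSemidef U, sum_colProj hU, fun i ↦ by simp [colProj_mul hU], fun i ↦ ?_⟩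
  have hdet : IsUnit U.det := Matrix.UnitaryGroup.det_isUnit ⟨U, hU⟩
  have hdet' : IsUnit (star U).det := by
    rw [Matrix.star_eq_conjTranspose, Matrix.det_conjTranspose]; exact hdet.star
  rw [colProj, Matrix.rank_mul_eq_left_of_isUnit_det _ _ hdet',
    Matrix.rank_mul_eq_right_of_isUnit_det _ _ hdet, ← Matrix.diagonal_single, Matrix.rank_diagonal]
  simp [Pi.single_apply]

theorem colProj_ne_zero {U : Mat ι} (hU : U ∈ Matrix.unitaryGroup ι ℂ) (i : ι) :
    colProj U i ≠ 0 := fun h ↦ by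
  simpa [h] using (isRankOnePVM_colProj hU).2.2.2 i

theorem eq_sum_eigenvalues_smul_colProj {A : Mat ι} (hA : A.IsHermitian) :
    A = ∑ i, hA.eigenvalues i • colProj (hA.eigenvectorUnitary : Mat ι) i := by
  rw [sum_smul_colProj]
  exact hA.spectral_theorem

theorem isCompact_unitaryGroup : IsCompact (Matrix.unitaryGroup ι ℂ : Set (Mat ι)) := by
  refine (isCompact_univ_pi fun _ ↦ isCompact_univ_pi fun _ ↦
    isCompact_closedBall (0 : ℂ) 1).of_isClosed_subset (isClosed_unitary (R := Mat ι)) ?_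
  intro U hU i _ j _
  simpa using entry_norm_bound_of_unitary hU i j

theorem KL_eq_sum_mul_log {X : Type*} [Fintype X] (P Q : X → ℝ) :
    KL P Q = ∑ x, P x * Real.log (P x / Q x) := by
  refine Finset.sum_congr rfl fun x _ ↦ ?_
  split_ifs with h <;> simp [h]

theorem expVal_colProj_colProj {U : Mat ι} (hU : U ∈ Matrix.unitaryGroup ι ℂ) (i j : ι) :
    expVal (colProj U i) (colProj U j) = if i = j then 1 else 0 := by
  change ((colProj U i * colProj U j).trace).re = _
  rw [colProj_mul hU]
  split_ifs
  · rw [colProj, Matrix.trace_mul_comm, ← Matrix.mul_assoc, Matrix.mem_unitaryGroup_iff'.mp hU]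
    simp
  · simp

/-- The eigenvectors of `∑ (p x / q x) • m x` give a projective measurement distinguishing the two
states at least as well as the POVM `m`. -/
theorem exists_unitary_KL_le {ρ0 ρ1 : Mat ι} (h0 : ρ0.PosDef) (h1 : ρ1.PosDef)
    {N : ℕ} {m : Fin N → Mat ι} (hm : IsPOVM m) :
    ∃ U ∈ Matrix.unitaryGroup ι ℂ,
      KL (outProb ρ0 m) (outProb ρ1 m) ≤ KL (outProb ρ0 (colProj U)) (outProb ρ1 (colProj U)) := by
  obtain ⟨hm0, hm1⟩ := hm
  let a : Fin N → ℝ := fun x ↦ if m x = 0 then 1 else expVal ρ0 (m x) / expVal ρ1 (m x)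
  have ha : ∀ x, 0 < a x := fun x ↦ by
    by_cases hx : m x = 0
    · simp [a, hx]
    · simpa [a, hx] using div_pos (expVal_pos h0 (hm0 x) hx) (expVal_pos h1 (hm0 x) hx)
  have hpsd : (∑ x, a x • m x).PosSemidef :=
    Matrix.posSemidef_sum _ fun x _ ↦ (hm0 x).smul (ha x).le
  let U : Mat ι := hpsd.isHermitian.eigenvectorUnitary
  have hU : U ∈ Matrix.unitaryGroup ι ℂ := hpsd.isHermitian.eigenvectorUnitary.2
  set w : ι → ℝ := hpsd.isHermitian.eigenvalues with hwdef
  have hwa : ∑ i, w i • colProj U i = ∑ x, a x • m x :=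
    (eq_sum_eigenvalues_smul_colProj hpsd.isHermitian).symm
  have htr : ∀ i j, expVal (colProj U i) (colProj U j) = if i = j then 1 else 0 :=
    expVal_colProj_colProj hU
  have hw : ∀ i, 0 < w i := by
    intro i
    have hwi : w i = ∑ x, a x * expVal (colProj U i) (m x) := by
      have h := congrArg (expVal (colProj U i)) hwa
      simpa [htr] using h
    have hone : ∑ x, expVal (colProj U i) (m x) = 1 := by
      rw [← map_sum, hm1, ← sum_colProj hU, map_sum]
      simp [htr]
    have hnn : ∀ x, 0 ≤ expVal (colProj U i) (m x) := fun x ↦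
      expVal_nonneg (colProj_posSemidef U i) (hm0 x)
    obtain ⟨x, -, hx⟩ := Finset.exists_ne_zero_of_sum_ne_zero (hone.trans_ne one_ne_zero)
    rw [hwi]
    exact Finset.sum_pos' (fun y _ ↦ mul_nonneg (ha y).le (hnn y))
      ⟨x, Finset.mem_univ x, mul_pos (ha x) ((hnn x).lt_of_ne' hx)⟩
  have hP : ∀ i, 0 < expVal ρ0 (colProj U i) := fun i ↦
    expVal_pos h0 (colProj_posSemidef U i) (colProj_ne_zero hU i)
  have hQ : ∀ i, 0 < expVal ρ1 (colProj U i) := fun i ↦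
    expVal_pos h1 (colProj_posSemidef U i) (colProj_ne_zero hU i)
  refine ⟨U, hU, ?_⟩
  have hmass : ∑ i, expVal ρ0 (colProj U i) = ∑ x, expVal ρ0 (m x) := by
    rw [← map_sum, ← map_sum, hm1, sum_colProj hU]
  have hQmass : ∑ i, w i * expVal ρ1 (colProj U i) = ∑ i, expVal ρ0 (colProj U i) := by
    have h := congrArg (expVal ρ1) hwa
    simp only [map_sum, map_smul, smul_eq_mul] at h
    rw [h, hmass]
    refine Finset.sum_congr rfl fun x _ ↦ ?_
    by_cases hx : m x = 0
    · simp [hx]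
    · simp [a, hx, (expVal_pos h1 (hm0 x) hx).ne']
  have hlog := sum_mul_log_le_of_sum_inv_le hw ha hmass fun t ht ↦
    sum_inv_mul_expVal_le h0.posSemidef hm0 hm1 (colProj_posSemidef U) (sum_colProj hU)
      (colProj_mul hU) (fun i ↦ add_pos_of_pos_of_nonneg (hw i) ht)
      (fun x ↦ add_pos_of_pos_of_nonneg (ha x) ht) <| by
        simp only [add_smul, Finset.sum_add_distrib, ← Finset.smul_sum, hm1, sum_colProj hU, hwa]
  simp only [KL_eq_sum_mul_log, outProb_eq_expVal]
  calc ∑ x, expVal ρ0 (m x) * Real.log (expVal ρ0 (m x) / expVal ρ1 (m x))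
      = ∑ x, expVal ρ0 (m x) * Real.log (a x) := Finset.sum_congr rfl fun x _ ↦ by
        by_cases hx : m x = 0 <;> simp [a, hx]
    _ ≤ ∑ i, expVal ρ0 (colProj U i) * Real.log (w i) := hlog
    _ ≤ ∑ i, (expVal ρ0 (colProj U i) *
          Real.log (expVal ρ0 (colProj U i) / expVal ρ1 (colProj U i)) +
          (w i * expVal ρ1 (colProj U i) - expVal ρ0 (colProj U i))) := by
        refine Finset.sum_le_sum fun i _ ↦ ?_
        have hp := hP i
        have hq := hQ i
        have h := Real.log_le_sub_one_of_pos
          (div_pos (hw i) (div_pos hp hq))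
        rw [Real.log_div (hw i).ne' (div_pos hp hq).ne'] at h
        have h' := mul_le_mul_of_nonneg_left h hp.le
        have heq : expVal ρ0 (colProj U i) *
            (w i / (expVal ρ0 (colProj U i) / expVal ρ1 (colProj U i)) - 1) =
            w i * expVal ρ1 (colProj U i) - expVal ρ0 (colProj U i) := by
          field_simp
        linarith
    _ = _ := by
        rw [Finset.sum_add_distrib, Finset.sum_sub_distrib, hQmass, sub_self, add_zero]

theorem continuous_outProb_colProj (ρ : Mat ι) (i : ι) :
    Continuous fun U : Mat ι ↦ outProb ρ (colProj U) i := by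
  unfold outProb colProj
  fun_prop

theorem exists_isMaxOn_KL_colProj {ρ0 ρ1 : Mat ι} (h0 : ρ0.PosDef) (h1 : ρ1.PosDef) :
    ∃ U ∈ Matrix.unitaryGroup ι ℂ, IsMaxOn
      (fun U ↦ KL (outProb ρ0 (colProj U)) (outProb ρ1 (colProj U)))
      (Matrix.unitaryGroup ι ℂ : Set (Mat ι)) U := by
  refine isCompact_unitaryGroup.exists_isMaxOn ⟨1, one_mem _⟩ ?_
  simp only [KL_eq_sum_mul_log]
  have hpos : ∀ {ρ : Mat ι}, ρ.PosDef → ∀ i, ∀ U ∈ (Matrix.unitaryGroup ι ℂ : Set (Mat ι)),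
      outProb ρ (colProj U) i ≠ 0 := fun h i U hU ↦
    (expVal_pos h (colProj_posSemidef U i) (colProj_ne_zero hU i)).ne'
  refine continuousOn_finsetSum _ fun i _ ↦ ?_
  have hc := fun ρ ↦ (continuous_outProb_colProj ρ i).continuousOn
    (s := (Matrix.unitaryGroup ι ℂ : Set (Mat ι)))
  exact (hc ρ0).mul (((hc ρ0).div (hc ρ1) (hpos h1 i)).log fun U hU ↦
    div_ne_zero (hpos h0 i U hU) (hpos h1 i U hU))

/-- Theorem 1 in the paper: for full-support states `ρ0, ρ1`
on `ℂ^d`, the supremum of `D(P_{ρ0,m}‖P_{ρ1,m})` over all finite outcome sets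
and all POVMs equals the measured relative entropy `D_M(ρ0‖ρ1)`, and it is
attained by a PVM with exactly `d` outcomes. -/
theorem measured_relative_entropy_sup_over_povms
    (d : ℕ) (hd : 0 < d) (ρ0 ρ1 : Mat (Fin d))
    (h0 : IsState ρ0) (h1 : IsState ρ1)
    (hfs0 : ρ0.PosDef) (hfs1 : ρ1.PosDef) :
    (∀ (N : ℕ) (m : Fin N → Mat (Fin d)), IsPOVM m →
        KL (outProb ρ0 m) (outProb ρ1 m) ≤ Dmeas ρ0 ρ1) ∧
    ∃ m : Fin d → Mat (Fin d), IsPVM m ∧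
        KL (outProb ρ0 m) (outProb ρ1 m) = Dmeas ρ0 ρ1 := by
  obtain ⟨U, hU, hmax⟩ := exists_isMaxOn_KL_colProj hfs0 hfs1
  have hPVM := isRankOnePVM_colProj hU
  have hle : ∀ (N : ℕ) (m : Fin N → Mat (Fin d)), IsPOVM m →
      KL (outProb ρ0 m) (outProb ρ1 m) ≤
        KL (outProb ρ0 (colProj U)) (outProb ρ1 (colProj U)) := fun N m hm ↦ by
    obtain ⟨V, hV, hVle⟩ := exists_unitary_KL_le hfs0 hfs1 hm
    exact hVle.trans (hmax hV)
  have heq : KL (outProb ρ0 (colProj U)) (outProb ρ1 (colProj U)) = Dmeas ρ0 ρ1 := by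
    have : Nonempty {m : Fin d → Mat (Fin d) // IsRankOnePVM m} := ⟨⟨colProj U, hPVM⟩⟩
    have hDle : ∀ m : {m : Fin d → Mat (Fin d) // IsRankOnePVM m},
        KL (outProb ρ0 m.1) (outProb ρ1 m.1) ≤
          KL (outProb ρ0 (colProj U)) (outProb ρ1 (colProj U)) :=
      fun m ↦ hle d m.1 ⟨m.2.1, m.2.2.1⟩
    exact le_antisymm (le_ciSup_of_le ⟨_, Set.forall_mem_range.mpr hDle⟩ ⟨colProj U, hPVM⟩ le_rfl)
      (ciSup_le hDle)
  exact ⟨fun N m hm ↦ (hle N m hm).trans_eq heq, colProj U,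
    ⟨⟨hPVM.1, hPVM.2.1⟩, hPVM.2.2.1⟩, heq⟩

end SQHT
end

section
/- Let ρ0 and ρ1 be quantum states on ℂ^d with full support, and let S = (𝒳, {μ_k, d_k}_{k≥1}, T) be any SQHT with max_{i∈{0,1}} E_i[T] < ∞ and with error probabilities α < 1 and β < 1. Then log(1/β) ≤ (E_0[T]·D_M(ρ0‖ρ1) + 1)/(1 − α) and log(1/α) ≤ (E_1[T]·D_M(ρ1‖ρ0) + 1)/(1 − β). -/
open MeasureTheory ProbabilityTheory Filter
open scoped ENNReal NNReal Topology ComplexOrder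

namespace SQHT

noncomputable instance (ι : Type) : MeasurableSpace (Mat ι) :=
  inferInstanceAs (MeasurableSpace (ι → ι → ℂ))

variable {ι : Type} [Fintype ι] [DecidableEq ι]

/-- The (compact) space of POVMs on `ℂ^ι` with outcome set `Fin N`. -/
abbrev POVM (ι : Type) [Fintype ι] [DecidableEq ι] (N : ℕ) :=
  {m : Fin N → Mat ι // IsPOVM m}

/-- Histories of `k` (measurement, outcome) pairs. -/
abbrev Hist (ι : Type) [Fintype ι] [DecidableEq ι] (N k : ℕ) := Fin k → POVM ι N × Fin N

/-- Infinite trajectories of (measurement, outcome) pairs. -/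
abbrev Traj (ι : Type) [Fintype ι] [DecidableEq ι] (N : ℕ) := ℕ → POVM ι N × Fin N

/-- A sequential quantum hypothesis test: a finite outcome set `Fin N`,
adaptive measurement strategies given by kernels from histories to POVMs,
and decision functions. `dec k` is the decision after `k+1` observations:
`none` means continue (`*`), `some false` accepts hypothesis 0, `some true` accepts 1. -/
structure SQHTtest (ι : Type) [Fintype ι] [DecidableEq ι] where
  N : ℕ
  μ : (k : ℕ) → Kernel (Hist ι N k) (POVM ι N)
  markov : ∀ k, IsMarkovKernel (μ k)
  dec : (k : ℕ) → Hist ι N (k + 1) → Option Bool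
  dec_meas : ∀ k o, MeasurableSet {h : Hist ι N (k + 1) | dec k h = o}

/-- The law of the outcome of measuring POVM `m` on state `ρ` (Born's rule). -/
noncomputable def outMeasure (ρ : Mat ι) {N : ℕ} (m : POVM ι N) : Measure (Fin N) :=
  ∑ x, (ENNReal.ofReal (outProb ρ m.1 x)) • Measure.dirac x

/-- The joint law of the first `k` (measurement, outcome) pairs when the
underlying state is `ρ`: `P[(A × x_1^k) × ⋯] = ∫_A ∏_j μ_j(dm_j|⋯) Tr[ρ m_j(x_j)]`. -/
noncomputable def stepLaw (ρ : Mat ι) {N : ℕ}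
    (μ : (k : ℕ) → Kernel (Hist ι N k) (POVM ι N)) :
    (k : ℕ) → Measure (Hist ι N k)
  | 0 => Measure.dirac (fun i => i.elim0)
  | (k + 1) => (stepLaw ρ μ k).bind fun h =>
      ((μ k) h).bind fun m => (outMeasure ρ m).map (fun x => Fin.snoc h (m, x))

/-- Restriction of a trajectory to its first `k` steps. -/
def pref {N : ℕ} (k : ℕ) (ω : Traj ι N) : Hist ι N k := fun i => ω i

/-- `P` is the law of the trajectory process of test `S` on state `ρ`. -/
def IsLaw (ρ : Mat ι) (S : SQHTtest ι) (P : Measure (Traj ι S.N)) : Prop :=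
  IsProbabilityMeasure P ∧ ∀ k, P.map (pref k) = stepLaw ρ S.μ k

/-- The test stops for the first time after `k+1` observations, declaring `b`. -/
def decidesAt (S : SQHTtest ι) (ω : Traj ι S.N) (k : ℕ) (b : Bool) : Prop :=
  (∀ j, j < k → S.dec j (pref (j + 1) ω) = none) ∧ S.dec k (pref (k + 1) ω) = some b

/-- Error of the first kind: probability (under `ρ0`) of declaring hypothesis 1. -/
noncomputable def errA (S : SQHTtest ι) (P0 : Measure (Traj ι S.N)) : ℝ≥0∞ :=
  P0 {ω | ∃ k, decidesAt S ω k true}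

/-- Error of the second kind: probability (under `ρ1`) of declaring hypothesis 0. -/
noncomputable def errB (S : SQHTtest ι) (P1 : Measure (Traj ι S.N)) : ℝ≥0∞ :=
  P1 {ω | ∃ k, decidesAt S ω k false}

/-- The stopping time `T` (number of samples used), as an extended real so that
`T = ∞` when the test never stops. `dec k` is the decision after `k+1` samples. -/
noncomputable def stopTime (S : SQHTtest ι) (ω : Traj ι S.N) : ℝ≥0∞ :=
  sInf {n : ℝ≥0∞ | ∃ k : ℕ, n = (k : ℝ≥0∞) + 1 ∧ S.dec k (pref (k + 1) ω) ≠ none}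

/-- Expected number of samples. -/
noncomputable def expT (S : SQHTtest ι) (P : Measure (Traj ι S.N)) : ℝ≥0∞ :=
  ∫⁻ ω, stopTime S ω ∂P

/-- Logarithm on `ℝ≥0∞` with values in `EReal` (`log 0 = ⊥`, `log ∞ = ⊤`). -/
noncomputable def elog (x : ℝ≥0∞) : EReal :=
  if x = 0 then ⊥ else if x = ∞ then ⊤ else ((Real.log x.toReal : ℝ) : EReal)

/-- `(R0, R1)` is an achievable error-exponent pair under the expectation
constraint, for discriminating `ρ0` from `ρ1`, with exponents normalized by
`n * l` (`l` is the block length; `l = 1` for single-copy tests). -/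
def AchievableE (ρ0 ρ1 : Mat ι) (l : ℕ) (R : ℝ × ℝ) : Prop :=
  0 ≤ R.1 ∧ 0 ≤ R.2 ∧
  ∃ (S : ℕ → SQHTtest ι) (P0 P1 : (n : ℕ) → Measure (Traj ι (S n).N)),
    (∀ n, IsLaw ρ0 (S n) (P0 n)) ∧ (∀ n, IsLaw ρ1 (S n) (P1 n)) ∧
    (R.1 : EReal) ≤ atTop.liminf
      (fun n : ℕ => ((((n * l : ℕ) : ℝ)⁻¹ : ℝ) : EReal) * (- elog (errA (S n) (P0 n)))) ∧
    (R.2 : EReal) ≤ atTop.liminf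
      (fun n : ℕ => ((((n * l : ℕ) : ℝ)⁻¹ : ℝ) : EReal) * (- elog (errB (S n) (P1 n)))) ∧
    atTop.limsup (fun n : ℕ =>
      (max (expT (S n) (P0 n)) (expT (S n) (P1 n)) : ℝ≥0∞).toEReal - (((n : ℝ)) : EReal)) ≤ 0

/-- `(R0, R1)` is an `ε`-achievable error-exponent pair under the probabilistic
constraint. -/
def AchievableP (ρ0 ρ1 : Mat ι) (l : ℕ) (ε : ℝ) (R : ℝ × ℝ) : Prop :=
  0 ≤ R.1 ∧ 0 ≤ R.2 ∧
  ∃ (S : ℕ → SQHTtest ι) (P0 P1 : (n : ℕ) → Measure (Traj ι (S n).N)),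
    (∀ n, IsLaw ρ0 (S n) (P0 n)) ∧ (∀ n, IsLaw ρ1 (S n) (P1 n)) ∧
    (R.1 : EReal) ≤ atTop.liminf
      (fun n : ℕ => ((((n * l : ℕ) : ℝ)⁻¹ : ℝ) : EReal) * (- elog (errA (S n) (P0 n)))) ∧
    (R.2 : EReal) ≤ atTop.liminf
      (fun n : ℕ => ((((n * l : ℕ) : ℝ)⁻¹ : ℝ) : EReal) * (- elog (errB (S n) (P1 n)))) ∧
    atTop.limsup (fun n : ℕ =>
      max ((P0 n) {ω | (n : ℝ≥0∞) < stopTime (S n) ω})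
          ((P1 n) {ω | (n : ℝ≥0∞) < stopTime (S n) ω})) < ENNReal.ofReal ε

end SQHT

namespace SQHT

open scoped Matrix

variable {ι : Type} [Fintype ι] [DecidableEq ι]

theorem trace_mul_re_nonneg {κ : Type} [Fintype κ] {A B : Mat κ} (hA : A.PosSemidef)
    (hB : B.PosSemidef) :
    0 ≤ ((A * B).trace).re := by
  obtain ⟨m, v, rfl⟩ := Matrix.posSemidef_iff_eq_sum_vecMulVec.1 hB
  rw [Finset.mul_sum, Matrix.trace_sum, Complex.re_sum]
  refine Finset.sum_nonneg fun i _ => ?_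
  rw [Matrix.mul_vecMulVec, Matrix.trace_vecMulVec, dotProduct_comm]
  exact (Complex.le_def.1 (hA.dotProduct_mulVec_nonneg (v i))).1

/-- Spectral decomposition of a Hermitian matrix along an orthogonal rank-one PVM. -/
theorem exists_rankOnePVM_eq_sum {A : Mat ι} (hA : A.IsHermitian) :
    ∃ e : ι → Mat ι, IsRankOnePVM e ∧ (∀ i j, i ≠ j → e i * e j = 0) ∧
      A = ∑ i, (hA.eigenvalues i : ℂ) • e i := by
  set U : Mat ι := (hA.eigenvectorUnitary : Mat ι) with hU
  have hUU : Uᴴ * U = 1 := Unitary.coe_star_mul_self hA.eigenvectorUnitary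
  have hUU' : U * Uᴴ = 1 := Unitary.coe_mul_star_self hA.eigenvectorUnitary
  have hmul : ∀ i j, (U * Matrix.single i i 1 * Uᴴ) * (U * Matrix.single j j 1 * Uᴴ) =
      U * (Matrix.single i i 1 * Matrix.single j j 1) * Uᴴ := by
    intro i j
    calc _ = U * Matrix.single i i 1 * (Uᴴ * U) * Matrix.single j j 1 * Uᴴ := by
            simp only [Matrix.mul_assoc]
      _ = _ := by rw [hUU]; simp only [Matrix.mul_assoc, Matrix.one_mul]
  refine ⟨fun i => U * Matrix.single i i 1 * Uᴴ, ⟨fun i => ?_, ?_, fun i => ?_, fun i => ?_⟩,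
    ?_, ?_⟩
  · refine Matrix.PosSemidef.mul_mul_conjTranspose_same ?_ U
    rw [← Matrix.diagonal_single]
    refine Matrix.PosSemidef.diagonal fun j => ?_
    by_cases h : j = i
    · subst h; simp
    · simp [h]
  · rw [← Finset.sum_mul, ← Finset.mul_sum, Matrix.sum_single_one, Matrix.mul_one, hUU']
  · rw [hmul]; simp
  · have hdetU : IsUnit U.det := (Matrix.isUnit_iff_isUnit_det U).1
      ⟨⟨U, Uᴴ, hUU', hUU⟩, rfl⟩
    have hdetU' : IsUnit (Uᴴ).det := (Matrix.isUnit_iff_isUnit_det _).1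
      ⟨⟨Uᴴ, U, hUU, hUU'⟩, rfl⟩
    rw [Matrix.rank_mul_eq_left_of_isUnit_det _ _ hdetU',
      Matrix.rank_mul_eq_right_of_isUnit_det _ _ hdetU, ← Matrix.diagonal_single,
      Matrix.rank_diagonal]
    rw [Fintype.card_eq_one_iff]
    refine ⟨⟨i, by simp⟩, fun j => Subtype.ext ?_⟩
    by_contra h
    exact j.2 (by simp [h])
  · intro i j hij
    rw [hmul]; simp [hij]
  · conv_lhs => rw [hA.spectral_theorem]
    have : Matrix.diagonal (RCLike.ofReal ∘ hA.eigenvalues : ι → ℂ) =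
        ∑ i, (hA.eigenvalues i : ℂ) • Matrix.single i i (1 : ℂ) := by
      ext a b
      simp [Matrix.sum_apply, Matrix.diagonal_apply, Matrix.single_apply]
      by_cases h : a = b
      · subst h; simp
      · rw [if_neg h, Finset.sum_eq_zero]
        rintro c -
        exact if_neg fun hc => h (hc.1.symm.trans hc.2)
    rw [Unitary.conjStarAlgAut_apply, this]
    rw [Finset.mul_sum, Finset.sum_mul]
    simp only [Matrix.mul_smul, Matrix.smul_mul]
    rfl

theorem outProb_nonneg {κ : Type} [Fintype κ] {ρ : Mat κ} (hρ : ρ.PosSemidef) {X : Type*}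
    {m : X → Mat κ} {x : X} (hm : (m x).PosSemidef) : 0 ≤ outProb ρ m x :=
  trace_mul_re_nonneg hρ hm

theorem sum_smul_outProb (ρ : Mat ι) {X : Type*} [Fintype X] (m : X → Mat ι) (a : X → ℝ) :
    ((ρ * ∑ x, (a x : ℂ) • m x).trace).re = ∑ x, a x * outProb ρ m x := by
  simp [Finset.mul_sum, Matrix.trace_sum, outProb]

theorem sum_outProb {ρ : Mat ι} (hρ : ρ.trace = 1) {X : Type*} [Fintype X] {m : X → Mat ι}
    (hm : ∑ x, m x = 1) : ∑ x, outProb ρ m x = 1 := by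
  have := sum_smul_outProb ρ m (fun _ => 1)
  simpa [hm, hρ] using this.symm

/-- Two states, the second of full support, dominate each other up to a constant. -/
theorem exists_outProb_le {ρ σ : Mat ι} (hρ : ρ.PosDef) (hσ : σ.PosDef) :
    ∃ C : ℝ, 0 < C ∧ ∀ {X : Type} (m : X → Mat ι) (x : X), (m x).PosSemidef →
      outProb ρ m x ≤ C * outProb σ m x := by
  obtain ⟨e, he, -, hρe⟩ := exists_rankOnePVM_eq_sum hρ.1
  obtain ⟨f, hf, -, hσf⟩ := exists_rankOnePVM_eq_sum hσ.1
  obtain ⟨M, hM⟩ : ∃ M : ℝ, ∀ i, hρ.1.eigenvalues i ≤ M :=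
    ⟨∑ i, hρ.1.eigenvalues i, fun i => Finset.single_le_sum
      (fun j _ => (hρ.eigenvalues_pos j).le) (Finset.mem_univ i)⟩
  obtain ⟨K, hK⟩ : ∃ K : ℝ, ∀ i, (hσ.1.eigenvalues i)⁻¹ ≤ K :=
    ⟨∑ i, (hσ.1.eigenvalues i)⁻¹, fun i => Finset.single_le_sum
      (f := fun i => (hσ.1.eigenvalues i)⁻¹)
      (fun j _ => (inv_pos.2 (hσ.eigenvalues_pos j)).le) (Finset.mem_univ i)⟩
  have hM' : 0 ≤ max M 1 := by positivity
  have hK' : 0 ≤ max K 1 := by positivity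
  refine ⟨max M 1 * max K 1, by positivity, fun m x hm => ?_⟩
  have expand : ∀ (e : ι → Mat ι) (a : ι → ℝ),
      ((( ∑ i, (a i : ℂ) • e i) * m x).trace).re = ∑ i, a i * ((e i * m x).trace).re := by
    intro e a
    simp [Finset.sum_mul, Matrix.trace_sum]
  have one : ∀ e : ι → Mat ι, ∑ i, e i = 1 → ((m x).trace).re = ∑ i, ((e i * m x).trace).re := by
    intro e he
    have := expand e (fun _ => 1)
    simpa [he] using this
  have hu : outProb ρ m x ≤ max M 1 * ((m x).trace).re := by
    rw [outProb, hρe, expand, one e he.2.1, Finset.mul_sum]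
    exact Finset.sum_le_sum fun i _ => mul_le_mul_of_nonneg_right
      ((hM i).trans (le_max_left _ _)) (trace_mul_re_nonneg (he.1 i) hm)
  have hl : ((m x).trace).re ≤ max K 1 * outProb σ m x := by
    rw [outProb, hσf, expand, one f hf.2.1, Finset.mul_sum]
    refine Finset.sum_le_sum fun i _ => ?_
    have h0 := trace_mul_re_nonneg (hf.1 i) hm
    have h1 : 1 ≤ max K 1 * hσ.1.eigenvalues i := by
      have hp := hσ.eigenvalues_pos i
      have := (hK i).trans (le_max_left K 1)
      calc (1 : ℝ) = (hσ.1.eigenvalues i)⁻¹ * hσ.1.eigenvalues i := (inv_mul_cancel₀ hp.ne').symm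
        _ ≤ _ := mul_le_mul_of_nonneg_right this hp.le
    nlinarith [mul_le_mul_of_nonneg_right h1 h0]
  calc outProb ρ m x ≤ max M 1 * ((m x).trace).re := hu
    _ ≤ max M 1 * (max K 1 * outProb σ m x) := mul_le_mul_of_nonneg_left hl hM'
    _ = _ := by ring

/-- Gibbs' inequality. -/
theorem KL_nonneg {X : Type*} [Fintype X] {P Q : X → ℝ} (hP : ∀ x, 0 ≤ P x) (hQ : ∀ x, 0 ≤ Q x)
    (hPQ : ∀ x, Q x = 0 → P x = 0) (h1 : ∑ x, Q x ≤ ∑ x, P x) : 0 ≤ KL P Q := by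
  refine le_trans (sub_nonneg.2 h1) ?_
  rw [← Finset.sum_sub_distrib]
  refine Finset.sum_le_sum fun x _ => ?_
  split_ifs with h
  · simpa [h] using hQ x
  · have hp : 0 < P x := lt_of_le_of_ne (hP x) (Ne.symm h)
    have hq : 0 < Q x := lt_of_le_of_ne (hQ x) fun h' => h (hPQ x h'.symm)
    have := Real.log_le_sub_one_of_pos (div_pos hq hp)
    rw [← inv_div, Real.log_inv]
    have h2 : P x * Real.log (Q x / P x) ≤ P x * (Q x / P x - 1) :=
      mul_le_mul_of_nonneg_left this hp.le
    have h3 : P x * (Q x / P x - 1) = Q x - P x := by field_simp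
    linarith

theorem sum_mul_log_le_KL {X : Type*} [Fintype X] {P Q : X → ℝ} {w : X → ℝ} (hP : ∀ x, 0 ≤ P x)
    (hQ : ∀ x, 0 ≤ Q x) (hw : ∀ x, 0 < w x) (hPQ : ∀ x, Q x = 0 → P x = 0)
    (h1 : ∑ x, w x * Q x ≤ ∑ x, P x) : ∑ x, P x * Real.log (w x) ≤ KL P Q := by
  have h := KL_nonneg (Q := fun x => w x * Q x) hP (fun x => mul_nonneg (hw x).le (hQ x))
    (fun x hx => hPQ x ((mul_eq_zero.1 hx).resolve_left (hw x).ne')) h1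
  have : KL P (fun x => w x * Q x) = KL P Q - ∑ x, P x * Real.log (w x) := by
    rw [KL, KL, ← Finset.sum_sub_distrib]
    refine Finset.sum_congr rfl fun x _ => ?_
    split_ifs with h
    · simp [h]
    · have hq : Q x ≠ 0 := fun h' => h (hPQ x h')
      rw [Real.log_div h (mul_ne_zero (hw x).ne' hq), Real.log_div h hq,
        Real.log_mul (hw x).ne' hq]
      ring
  linarith

/-- Operator Jensen inequality for the inverse, traced against a state. -/
theorem trace_mul_inv_le {ρ W : Mat ι} (hρ : ρ.PosSemidef) {X : Type*} [Fintype X] {m : X → Mat ι}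
    (hm : ∀ x, (m x).PosSemidef) (hm1 : ∑ x, m x = 1) {a : X → ℝ} (ha : ∀ x, 0 < a x)
    (hW : W.IsHermitian) (hWA : W * ∑ x, (a x : ℂ) • m x = 1) :
    ((ρ * W).trace).re ≤ ∑ x, (a x)⁻¹ * outProb ρ m x := by
  have hterm : ∀ x, 0 ≤ ((ρ * (((a x)⁻¹ : ℝ) : ℂ) •
      ((1 - (a x : ℂ) • W) * m x * (1 - (a x : ℂ) • W)ᴴ)).trace).re := by
    intro x
    refine trace_mul_re_nonneg hρ ?_
    refine Matrix.PosSemidef.smul ((hm x).mul_mul_conjTranspose_same _) ?_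
    rw [Complex.zero_le_real]
    exact (inv_pos.2 (ha x)).le
  have hexp : ∀ x, (((a x)⁻¹ : ℝ) : ℂ) • ((1 - (a x : ℂ) • W) * m x * (1 - (a x : ℂ) • W)ᴴ) =
      (((a x)⁻¹ : ℝ) : ℂ) • m x - W * m x - m x * W + W * ((a x : ℂ) • m x) * W := by
    intro x
    have hax : (a x : ℂ) ≠ 0 := by exact_mod_cast (ha x).ne'
    have : (1 - (a x : ℂ) • W)ᴴ = 1 - (a x : ℂ) • W := by
      rw [Matrix.conjTranspose_sub, Matrix.conjTranspose_smul, hW.eq]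
      simp
    rw [this]
    simp only [sub_mul, mul_sub, Matrix.one_mul, Matrix.mul_one, Matrix.smul_mul, Matrix.mul_smul,
      smul_sub, smul_smul, Complex.ofReal_inv, inv_mul_cancel₀ hax, one_smul]
    rw [← mul_assoc, inv_mul_cancel₀ hax, one_mul]
    abel
  have hsum : ∑ x, (((a x)⁻¹ : ℝ) : ℂ) • ((1 - (a x : ℂ) • W) * m x * (1 - (a x : ℂ) • W)ᴴ) =
      ∑ x, (((a x)⁻¹ : ℝ) : ℂ) • m x - W := by
    simp only [hexp, Finset.sum_add_distrib, Finset.sum_sub_distrib]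
    rw [← Finset.mul_sum, ← Finset.sum_mul, ← Finset.sum_mul, ← Finset.mul_sum, hWA, hm1]
    simp
  have h0 : 0 ≤ ((ρ * ∑ x, (((a x)⁻¹ : ℝ) : ℂ) •
      ((1 - (a x : ℂ) • W) * m x * (1 - (a x : ℂ) • W)ᴴ)).trace).re := by
    rw [Finset.mul_sum, Matrix.trace_sum, Complex.re_sum]
    exact Finset.sum_nonneg fun x _ => hterm x
  rw [hsum, mul_sub, Matrix.trace_sub, Complex.sub_re, sum_smul_outProb] at h0
  linarith

theorem tendsto_log_add_sub_log (a : ℝ) :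
    Tendsto (fun t : ℝ => Real.log (a + t) - Real.log t) atTop (𝓝 0) := by
  have h := Real.tendsto_log_comp_add_sub_log a
  simpa [add_comm] using h

/-- If a weighted sum of resolvents dominates another one of the same total weight, then the
corresponding weighted sum of logarithms is dominated. -/
theorem sum_mul_log_le_of_resolvent {X Y : Type*} [Fintype X] [Fintype Y] {c a : X → ℝ}
    {w b : Y → ℝ} (ha : ∀ x, 0 < a x) (hb : ∀ y, 0 < b y) (hcw : ∑ x, c x = ∑ y, w y)
    (h : ∀ t : ℝ, 0 ≤ t → ∑ y, (b y + t)⁻¹ * w y ≤ ∑ x, (a x + t)⁻¹ * c x) :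
    ∑ x, c x * Real.log (a x) ≤ ∑ y, w y * Real.log (b y) := by
  set g : ℝ → ℝ := fun t => ∑ x, c x * Real.log (a x + t) - ∑ y, w y * Real.log (b y + t)
    with hg
  have hd : ∀ t : ℝ, 0 ≤ t →
      HasDerivAt g (∑ x, c x * (a x + t)⁻¹ - ∑ y, w y * (b y + t)⁻¹) t := by
    intro t ht
    refine HasDerivAt.fun_sub (HasDerivAt.fun_sum fun x _ => ?_) (HasDerivAt.fun_sum fun y _ => ?_)
    · have h1 := ((hasDerivAt_id t).const_add (a x)).log (by have := ha x; simp; positivity)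
      simpa using h1.const_mul (c x)
    · have h1 := ((hasDerivAt_id t).const_add (b y)).log (by have := hb y; simp; positivity)
      simpa using h1.const_mul (w y)
  have hmono : MonotoneOn g (Set.Ici 0) := by
    refine monotoneOn_of_deriv_nonneg (convex_Ici 0)
      (fun t ht => (hd t ht).continuousAt.continuousWithinAt)
      (fun t ht => (hd t (interior_subset ht)).differentiableAt.differentiableWithinAt) ?_
    intro t ht
    rw [(hd t (interior_subset ht)).deriv]
    have := h t (interior_subset ht)
    simp only [mul_comm] at this ⊢
    linarith
  have hlim : Tendsto g atTop (𝓝 0) := by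
    have h1 : Tendsto (fun t : ℝ => ∑ x, c x * (Real.log (a x + t) - Real.log t) -
        ∑ y, w y * (Real.log (b y + t) - Real.log t)) atTop (𝓝 0) := by
      have := (tendsto_finsetSum (f := fun x t => c x * (Real.log (a x + t) - Real.log t))
        Finset.univ fun x _ => (tendsto_log_add_sub_log (a x)).const_mul (c x)).sub
        (tendsto_finsetSum (f := fun y t => w y * (Real.log (b y + t) - Real.log t))
          Finset.univ fun y _ => (tendsto_log_add_sub_log (b y)).const_mul (w y))
      simpa using this
    refine h1.congr fun t => ?_
    simp only [hg, mul_sub, Finset.sum_sub_distrib, ← Finset.sum_mul, hcw]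
    ring
  have hle : g 0 ≤ 0 := by
    refine ge_of_tendsto hlim ?_
    filter_upwards [eventually_ge_atTop 0] with t ht
    exact hmono Set.self_mem_Ici ht ht
  simpa [hg] using hle

/-- The relative entropy of the outcomes of any POVM is at most the measured relative entropy. -/
theorem KL_le_Dmeas {ρ σ : Mat ι} (hρ : IsState ρ) (hσ : IsState σ) (hρ' : ρ.PosDef)
    (hσ' : σ.PosDef) {X : Type} [Fintype X] {m : X → Mat ι} (hm : ∀ x, (m x).PosSemidef)
    (hm1 : ∑ x, m x = 1) : KL (outProb ρ m) (outProb σ m) ≤ Dmeas ρ σ := by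
  obtain ⟨C, hC, hCle⟩ := exists_outProb_le hρ' hσ'
  obtain ⟨C', hC', hCle'⟩ := exists_outProb_le hσ' hρ'
  have hzero : ∀ {X : Type} (m : X → Mat ι) (x : X), (m x).PosSemidef →
      (outProb σ m x = 0 → outProb ρ m x = 0) ∧ (outProb ρ m x = 0 → outProb σ m x = 0) := by
    intro X m x hm
    refine ⟨fun h => le_antisymm ?_ (outProb_nonneg hρ.1 hm),
      fun h => le_antisymm ?_ (outProb_nonneg hσ.1 hm)⟩
    · simpa [h] using hCle m x hm
    · simpa [h] using hCle' m x hm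
  have hbdd : BddAbove (Set.range fun e : {e : ι → Mat ι // IsRankOnePVM e} =>
      KL (outProb ρ e.1) (outProb σ e.1)) := by
    refine ⟨∑ _x : ι, |Real.log C|, ?_⟩
    rintro _ ⟨e, rfl⟩
    refine Finset.sum_le_sum fun x _ => ?_
    split_ifs with h
    · positivity
    · have hp0 := outProb_nonneg hρ.1 (e.2.1 x)
      have hp : 0 < outProb ρ e.1 x := lt_of_le_of_ne hp0 (Ne.symm h)
      have hq : 0 < outProb σ e.1 x := lt_of_le_of_ne (outProb_nonneg hσ.1 (e.2.1 x))
        fun h' => h ((hzero e.1 x (e.2.1 x)).1 h'.symm)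
      have hp1 : outProb ρ e.1 x ≤ 1 := by
        rw [← sum_outProb hρ.2 e.2.2.1]
        exact Finset.single_le_sum (f := outProb ρ e.1)
          (fun y _ => outProb_nonneg hρ.1 (e.2.1 y)) (Finset.mem_univ x)
      have hlog : Real.log (outProb ρ e.1 x / outProb σ e.1 x) ≤ Real.log C :=
        Real.log_le_log (div_pos hp hq) ((div_le_iff₀ hq).2 (hCle e.1 x (e.2.1 x)))
      calc _ ≤ outProb ρ e.1 x * |Real.log C| :=
            mul_le_mul_of_nonneg_left (hlog.trans (le_abs_self _)) hp0
        _ ≤ 1 * |Real.log C| := mul_le_mul_of_nonneg_right hp1 (abs_nonneg _)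
        _ = _ := one_mul _
  set a : X → ℝ := fun x => if outProb ρ m x = 0 then 1 else outProb ρ m x / outProb σ m x with ha
  have hapos : ∀ x, 0 < a x := by
    intro x
    simp only [ha]
    split_ifs with h
    · exact one_pos
    · exact div_pos (lt_of_le_of_ne (outProb_nonneg hρ.1 (hm x)) (Ne.symm h))
        (lt_of_le_of_ne (outProb_nonneg hσ.1 (hm x)) fun h' => h ((hzero m x (hm x)).1 h'.symm))
  set A : Mat ι := ∑ x, (a x : ℂ) • m x with hA
  have hApos : A.PosDef := by
    obtain ⟨c, hc, hca⟩ : ∃ c : ℝ, 0 < c ∧ ∀ x, c ≤ a x := by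
      have hs : 0 < ∑ x, (a x)⁻¹ + 1 :=
        add_pos_of_nonneg_of_pos (Finset.sum_nonneg fun x _ => (inv_pos.2 (hapos x)).le) one_pos
      refine ⟨(∑ x, (a x)⁻¹ + 1)⁻¹, inv_pos.2 hs, fun x => ?_⟩
      rw [inv_le_comm₀ hs (hapos x)]
      have := Finset.single_le_sum (f := fun x => (a x)⁻¹)
        (fun y _ => (inv_pos.2 (hapos y)).le) (Finset.mem_univ x)
      linarith
    have : A = (c : ℂ) • (1 : Mat ι) + ∑ x, ((a x - c : ℝ) : ℂ) • m x := by
      simp only [Complex.ofReal_sub, sub_smul, Finset.sum_sub_distrib, ← Finset.smul_sum, hm1, hA]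
      abel
    rw [this]
    refine Matrix.PosDef.add_posSemidef (Matrix.PosDef.one.smul ?_)
      (Matrix.posSemidef_sum _ fun x _ => (hm x).smul ?_)
    · exact_mod_cast hc
    · rw [Complex.zero_le_real]; linarith [hca x]
  obtain ⟨e, he, horth, hAe⟩ := exists_rankOnePVM_eq_sum hApos.1
  set b : ι → ℝ := hApos.1.eigenvalues with hb
  have hbpos : ∀ i, 0 < b i := hApos.eigenvalues_pos
  have hKL : KL (outProb ρ m) (outProb σ m) = ∑ x, outProb ρ m x * Real.log (a x) := by
    refine Finset.sum_congr rfl fun x _ => ?_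
    simp only [ha]
    split_ifs with h
    · simp
    · rfl
  have hlog : ∑ x, outProb ρ m x * Real.log (a x) ≤ ∑ i, outProb ρ e i * Real.log (b i) := by
    refine sum_mul_log_le_of_resolvent hapos hbpos
      (by rw [sum_outProb hρ.2 hm1, sum_outProb hρ.2 he.2.1]) fun t ht => ?_
    have hat : ∀ x, 0 < a x + t := fun x => add_pos_of_pos_of_nonneg (hapos x) ht
    have hbt : ∀ i, 0 < b i + t := fun i => add_pos_of_pos_of_nonneg (hbpos i) ht
    rw [← sum_smul_outProb]
    refine trace_mul_inv_le hρ.1 hm hm1 hat ?_ ?_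
    · rw [Matrix.IsHermitian, Matrix.conjTranspose_sum]
      refine Finset.sum_congr rfl fun i _ => ?_
      rw [Matrix.conjTranspose_smul, (he.1 i).1.eq]
      simp
    · have hAt : ∑ x, ((a x + t : ℝ) : ℂ) • m x = ∑ i, ((b i + t : ℝ) : ℂ) • e i := by
        simp only [Complex.ofReal_add, add_smul, Finset.sum_add_distrib, ← Finset.smul_sum, hm1,
          he.2.1]
        rw [← hA, hAe]
      rw [hAt, Finset.sum_mul, ← he.2.1]
      refine Finset.sum_congr rfl fun i _ => ?_
      rw [Finset.mul_sum, Finset.sum_eq_single i]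
      · have : ((b i + t : ℝ) : ℂ) ≠ 0 := by exact_mod_cast (hbt i).ne'
        rw [Matrix.smul_mul, Matrix.mul_smul, he.2.2.1, smul_smul, Complex.ofReal_inv,
          inv_mul_cancel₀ this, one_smul]
      · intro j _ hj
        rw [Matrix.smul_mul, Matrix.mul_smul, horth i j hj.symm, smul_zero, smul_zero]
      · simp
  have hGibbs : ∑ i, outProb ρ e i * Real.log (b i) ≤ KL (outProb ρ e) (outProb σ e) := by
    refine sum_mul_log_le_KL (fun i => outProb_nonneg hρ.1 (he.1 i))
      (fun i => outProb_nonneg hσ.1 (he.1 i)) hbpos (fun i => (hzero e i (he.1 i)).1) ?_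
    rw [← sum_smul_outProb, ← hAe, hA, sum_smul_outProb, sum_outProb hρ.2 he.2.1,
      ← sum_outProb hρ.2 hm1]
    refine Finset.sum_le_sum fun x _ => ?_
    simp only [ha]
    split_ifs with h
    · rw [h, (hzero m x (hm x)).2 h, mul_zero]
    · rw [div_mul_cancel₀]
      exact fun h' => h ((hzero m x (hm x)).1 h')
  calc _ ≤ KL (outProb ρ e) (outProb σ e) := hKL ▸ hlog.trans hGibbs
    _ ≤ Dmeas ρ σ := le_ciSup hbdd ⟨e, he⟩

theorem Dmeas_nonneg {ρ σ : Mat ι} (hρ : IsState ρ) (hσ : IsState σ) (hρ' : ρ.PosDef)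
    (hσ' : σ.PosDef) : 0 ≤ Dmeas ρ σ := by
  obtain ⟨C, hC, hCle⟩ := exists_outProb_le hρ' hσ'
  refine Real.iSup_nonneg fun e => KL_nonneg (fun i => outProb_nonneg hρ.1 (e.2.1 i))
    (fun i => outProb_nonneg hσ.1 (e.2.1 i)) (fun i h => ?_) ?_
  · exact le_antisymm (by simpa [h] using hCle e.1 i (e.2.1 i)) (outProb_nonneg hρ.1 (e.2.1 i))
  · rw [sum_outProb hρ.2 e.2.2.1, sum_outProb hσ.2 e.2.2.1]

theorem measurable_entry {κ : Type} (i j : κ) : Measurable fun A : Mat κ => A i j :=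
  (measurable_pi_apply j).comp (measurable_pi_apply (X := fun _ : κ => κ → ℂ) i)

theorem measurable_outProb (ρ : Mat ι) {N : ℕ} (x : Fin N) :
    Measurable fun m : POVM ι N => outProb ρ m.1 x := by
  have h : ∀ i j, Measurable fun m : POVM ι N => m.1 x i j := fun i j =>
    (measurable_entry i j).comp ((measurable_pi_apply x).comp measurable_subtype_coe)
  simp only [outProb, Matrix.trace, Matrix.diag, Matrix.mul_apply]
  exact Complex.measurable_re.comp (Finset.measurable_sum _ fun i _ =>
    Finset.measurable_sum _ fun j _ => (h j i).const_mul _)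

theorem measurable_snoc {N k : ℕ} : Measurable fun p : Hist ι N k × (POVM ι N × Fin N) =>
    (Fin.snoc p.1 p.2 : Hist ι N (k + 1)) := by
  refine measurable_pi_iff.2 fun i => ?_
  refine Fin.lastCases ?_ (fun i => ?_) i
  · simpa using measurable_snd
  · simp only [Fin.snoc_castSucc]
    exact (measurable_pi_apply i).comp measurable_fst

theorem lintegral_outMeasure (ρ : Mat ι) {N : ℕ} (m : POVM ι N) (f : Fin N → ℝ≥0∞) :
    ∫⁻ x, f x ∂(outMeasure ρ m) = ∑ x, ENNReal.ofReal (outProb ρ m.1 x) * f x := by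
  simp [outMeasure]

theorem measurable_sum_outProb_mul (ρ : Mat ι) {N k : ℕ} {F : Hist ι N (k + 1) → ℝ≥0∞}
    (hF : Measurable F) : Measurable fun p : Hist ι N k × POVM ι N =>
      ∑ x, ENNReal.ofReal (outProb ρ p.2.1 x) * F (Fin.snoc p.1 (p.2, x)) := by
  refine Finset.measurable_sum _ fun x _ => Measurable.mul ?_ (hF.comp ?_)
  · exact ((measurable_outProb ρ x).comp measurable_snd).ennreal_ofReal
  · exact measurable_snoc.comp
      (measurable_fst.prodMk (measurable_snd.prodMk measurable_const))

/-- Conditional law of the extended history given the past and the next measurement. -/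
theorem lintegral_map_snoc (ρ : Mat ι) {N k : ℕ} (h : Hist ι N k) (m : POVM ι N)
    {F : Hist ι N (k + 1) → ℝ≥0∞} (hF : Measurable F) :
    ∫⁻ h', F h' ∂((outMeasure ρ m).map fun x => (Fin.snoc h (m, x) : Hist ι N (k + 1))) =
      ∑ x, ENNReal.ofReal (outProb ρ m.1 x) * F (Fin.snoc h (m, x)) := by
  rw [lintegral_map hF (Measurable.of_discrete), lintegral_outMeasure]

theorem measurable_map_snoc (ρ : Mat ι) {N k : ℕ} :
    Measurable fun p : Hist ι N k × POVM ι N =>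
      (outMeasure ρ p.2).map fun x => (Fin.snoc p.1 (p.2, x) : Hist ι N (k + 1)) := by
  refine Measure.measurable_of_measurable_coe _ fun s hs => ?_
  have h := measurable_sum_outProb_mul ρ (k := k) (N := N) (measurable_one.indicator hs)
  refine (congrArg Measurable (funext fun p => ?_)).mpr h
  rw [← lintegral_map_snoc ρ p.1 p.2 (measurable_one.indicator hs), lintegral_indicator_one hs]

theorem lintegral_stepLaw_succ (ρ : Mat ι) {N : ℕ}
    (μ : (k : ℕ) → Kernel (Hist ι N k) (POVM ι N)) (hμ : ∀ k, IsMarkovKernel (μ k)) (k : ℕ)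
    {F : Hist ι N (k + 1) → ℝ≥0∞} (hF : Measurable F) :
    ∫⁻ h, F h ∂(stepLaw ρ μ (k + 1)) = ∫⁻ h, ∫⁻ m, ∑ x,
      ENNReal.ofReal (outProb ρ m.1 x) * F (Fin.snoc h (m, x)) ∂(μ k h) ∂(stepLaw ρ μ k) := by
  have hin : ∀ h : Hist ι N k, Measurable fun m : POVM ι N =>
      (outMeasure ρ m).map fun x => (Fin.snoc h (m, x) : Hist ι N (k + 1)) :=
    fun h => (measurable_map_snoc ρ).comp (measurable_const.prodMk measurable_id)
  have hinner : ∀ (h : Hist ι N k) {G : Hist ι N (k + 1) → ℝ≥0∞}, Measurable G →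
      ∫⁻ h', G h' ∂((μ k h).bind fun m =>
        (outMeasure ρ m).map fun x => (Fin.snoc h (m, x) : Hist ι N (k + 1))) =
      ∫⁻ m, ∑ x, ENNReal.ofReal (outProb ρ m.1 x) * G (Fin.snoc h (m, x)) ∂(μ k h) := by
    intro h G hG
    rw [Measure.lintegral_bind (hin h).aemeasurable hG.aemeasurable]
    exact lintegral_congr fun m => lintegral_map_snoc ρ h m hG
  have hmeas : Measurable fun h : Hist ι N k => (μ k h).bind fun m =>
      (outMeasure ρ m).map fun x => (Fin.snoc h (m, x) : Hist ι N (k + 1)) := by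
    refine Measure.measurable_of_measurable_coe _ fun s hs => ?_
    have h := (measurable_sum_outProb_mul ρ (k := k) (N := N)
      (measurable_one.indicator hs)).lintegral_kernel_prod_right' (κ := μ k)
    refine (congrArg Measurable (funext fun p => ?_)).mpr h
    rw [← lintegral_indicator_one hs, hinner p (measurable_one.indicator hs)]
  rw [stepLaw, Measure.lintegral_bind hmeas.aemeasurable hF.aemeasurable]
  exact lintegral_congr fun h => hinner h hF

/-- Log-likelihood ratio of a single observation. -/
noncomputable def logRatio (ρ σ : Mat ι) {N : ℕ} (p : POVM ι N × Fin N) : ℝ :=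
  Real.log (outProb ρ p.1.1 p.2 / outProb σ p.1.1 p.2)

theorem measurable_logRatio (ρ σ : Mat ι) {N : ℕ} :
    Measurable (logRatio ρ σ : POVM ι N × Fin N → ℝ) := by
  refine measurable_from_prod_countable_left fun x => ?_
  exact ((measurable_outProb ρ x).div (measurable_outProb σ x)).log

theorem exists_abs_logRatio_le {ρ σ : Mat ι} (hρ : ρ.PosDef) (hσ : σ.PosDef) :
    ∃ K : ℝ, 0 ≤ K ∧ ∀ {N : ℕ} (p : POVM ι N × Fin N), |logRatio ρ σ p| ≤ K := by
  obtain ⟨C, hC, hCle⟩ := exists_outProb_le hρ hσ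
  obtain ⟨L, hL, hLle⟩ := exists_outProb_le hσ hρ
  refine ⟨|Real.log C| + |Real.log L|, by positivity, fun p => ?_⟩
  have h1 := hCle p.1.1 p.2 (p.1.2.1 p.2)
  have h2 := hLle p.1.1 p.2 (p.1.2.1 p.2)
  have hp := outProb_nonneg hρ.posSemidef (p.1.2.1 p.2)
  have hq := outProb_nonneg hσ.posSemidef (p.1.2.1 p.2)
  rw [logRatio]
  rcases hp.eq_or_lt with hp | hp
  · rw [← hp]; simp; positivity
  rcases hq.eq_or_lt with hq | hq
  · rw [← hq]; simp; positivity
  have hu := Real.log_le_log (div_pos hp hq) ((div_le_iff₀ hq).2 h1)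
  have hl := Real.log_le_log (div_pos hq hp) ((div_le_iff₀ hp).2 h2)
  rw [← inv_div, Real.log_inv] at hl
  rw [abs_le]
  constructor
  · linarith [le_abs_self (Real.log L), abs_nonneg (Real.log C)]
  · linarith [le_abs_self (Real.log C), abs_nonneg (Real.log L)]

/-- The likelihood ratio of `σ` against `ρ` for a single observation. -/
noncomputable def likRatio (ρ σ : Mat ι) {N : ℕ} (p : POVM ι N × Fin N) : ℝ≥0∞ :=
  ENNReal.ofReal (Real.exp (-logRatio ρ σ p))

theorem measurable_likRatio (ρ σ : Mat ι) {N : ℕ} :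
    Measurable (likRatio ρ σ : POVM ι N × Fin N → ℝ≥0∞) :=
  ((measurable_logRatio ρ σ).neg.exp).ennreal_ofReal

theorem ofReal_outProb_mul_likRatio_le {ρ σ : Mat ι} (hρ : ρ.PosDef) (hσ : σ.PosDef) {N : ℕ}
    (m : POVM ι N) (x : Fin N) :
    ENNReal.ofReal (outProb ρ m.1 x) * likRatio ρ σ (m, x) ≤
      ENNReal.ofReal (outProb σ m.1 x) := by
  obtain ⟨C, hC, hCle⟩ := exists_outProb_le hρ hσ
  have hp := outProb_nonneg hρ.posSemidef (m.2.1 x)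
  rw [likRatio, ← ENNReal.ofReal_mul hp]
  refine ENNReal.ofReal_le_ofReal ?_
  rcases hp.eq_or_lt with hp | hp
  · rw [← hp, zero_mul]; exact outProb_nonneg hσ.posSemidef (m.2.1 x)
  have hq : 0 < outProb σ m.1 x := by
    have := hCle m.1 x (m.2.1 x)
    by_contra h
    nlinarith
  rw [logRatio, Real.exp_neg, Real.exp_log (div_pos hp hq), inv_div, mul_div_cancel₀]
  exact hp.ne'

theorem lintegral_prod_likRatio_mul_le {ρ σ : Mat ι} (hρ : ρ.PosDef) (hσ : σ.PosDef) {N : ℕ}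
    (μ : (k : ℕ) → Kernel (Hist ι N k) (POVM ι N)) (hμ : ∀ k, IsMarkovKernel (μ k)) (k : ℕ)
    {G : Hist ι N k → ℝ≥0∞} (hG : Measurable G) :
    ∫⁻ h, (∏ j, likRatio ρ σ (h j)) * G h ∂(stepLaw ρ μ k) ≤ ∫⁻ h, G h ∂(stepLaw σ μ k) := by
  induction k with
  | zero => simp [stepLaw]
  | succ k ih =>
    have hL : ∀ n, Measurable fun h : Hist ι N n => ∏ j, likRatio ρ σ (h j) := fun n =>
      Finset.measurable_prod _ fun j _ => (measurable_likRatio ρ σ).comp (measurable_pi_apply j)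
    have hmeas := measurable_sum_outProb_mul σ (k := k) (N := N) hG
    rw [lintegral_stepLaw_succ ρ μ hμ k
      (F := fun h => (∏ j, likRatio ρ σ (h j)) * G h) ((hL _).mul hG),
      lintegral_stepLaw_succ σ μ hμ k hG]
    refine le_trans (lintegral_mono fun h => ?_)
      (ih (G := fun h => ∫⁻ m, ∑ x, ENNReal.ofReal (outProb σ m.1 x) * G (Fin.snoc h (m, x))
        ∂(μ k h)) (hmeas.lintegral_kernel_prod_right' (κ := μ k)))
    have hm : Measurable fun m : POVM ι N =>
        ∑ x, ENNReal.ofReal (outProb σ m.1 x) * G (Fin.snoc h (m, x)) :=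
      Measurable.of_uncurry_left (f := fun (h : Hist ι N k) (m : POVM ι N) =>
        ∑ x, ENNReal.ofReal (outProb σ m.1 x) * G (Fin.snoc h (m, x))) hmeas
    rw [← lintegral_const_mul _ hm]
    refine lintegral_mono fun m => ?_
    rw [Finset.mul_sum]
    refine Finset.sum_le_sum fun x _ => ?_
    rw [Fin.prod_univ_castSucc]
    simp only [Fin.snoc_castSucc, Fin.snoc_last]
    calc _ = (∏ j, likRatio ρ σ (h j)) *
          ((ENNReal.ofReal (outProb ρ m.1 x) * likRatio ρ σ (m, x)) * G (Fin.snoc h (m, x))) := by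
          ring
      _ ≤ _ := by
          gcongr
          exact ofReal_outProb_mul_likRatio_le hρ hσ m x

theorem measurable_pref {N : ℕ} (k : ℕ) : Measurable (pref k : Traj ι N → Hist ι N k) :=
  measurable_pi_iff.2 fun i => measurable_pi_apply (i : ℕ)

/-- The σ-algebra on trajectories generated by the first `k` steps. -/
noncomputable abbrev past (ι : Type) [Fintype ι] [DecidableEq ι] (N k : ℕ) :
    MeasurableSpace (Traj ι N) :=
  MeasurableSpace.comap (pref k) inferInstance

theorem past_le {N : ℕ} (k : ℕ) : past ι N k ≤ MeasurableSpace.pi :=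
  (measurable_pref k).comap_le

theorem past_mono {N j k : ℕ} (hjk : j ≤ k) : past ι N j ≤ past ι N k := by
  rintro _ ⟨s, hs, rfl⟩
  exact ⟨(fun (h : Hist ι N k) (i : Fin j) => h ⟨i, i.2.trans_le hjk⟩) ⁻¹' s,
    (measurable_pi_iff.2 fun i => measurable_pi_apply _) hs, rfl⟩

/-- The trajectories on which the test has not stopped after `k` observations. -/
def running (S : SQHTtest ι) (k : ℕ) : Set (Traj ι S.N) :=
  {ω | ∀ j, j < k → S.dec j (pref (j + 1) ω) = none}

/-- The trajectories on which the test has declared `b` within `k` observations. -/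
def declared (S : SQHTtest ι) (b : Bool) (k : ℕ) : Set (Traj ι S.N) :=
  {ω | ∃ j < k, decidesAt S ω j b}

theorem measurableSet_dec (S : SQHTtest ι) (j : ℕ) (o : Option Bool) :
    MeasurableSet[past ι S.N (j + 1)] {ω | S.dec j (pref (j + 1) ω) = o} :=
  ⟨_, S.dec_meas j o, rfl⟩

theorem measurableSet_running (S : SQHTtest ι) (k : ℕ) :
    MeasurableSet[past ι S.N k] (running S k) := by
  have : running S k = ⋂ j : ℕ, ⋂ _ : j < k, {ω | S.dec j (pref (j + 1) ω) = none} := by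
    ext ω; simp [running]
  rw [this]
  exact MeasurableSet.iInter fun j => MeasurableSet.iInter fun hj =>
    past_mono hj _ (measurableSet_dec S j none)

theorem measurableSet_decidesAt (S : SQHTtest ι) (k : ℕ) (b : Bool) :
    MeasurableSet[past ι S.N (k + 1)] {ω | decidesAt S ω k b} :=
  (past_mono k.le_succ _ (measurableSet_running S k)).inter (measurableSet_dec S k (some b))

theorem measurableSet_declared (S : SQHTtest ι) (b : Bool) (k : ℕ) :
    MeasurableSet (declared S b k) := by
  have : declared S b k = ⋃ j : ℕ, ⋃ _ : j < k, {ω | decidesAt S ω j b} := by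
    ext ω; simp [declared]
  rw [this]
  exact MeasurableSet.iUnion fun j => MeasurableSet.iUnion fun _ =>
    past_le _ _ (measurableSet_decidesAt S j b)

theorem running_anti (S : SQHTtest ι) {j k : ℕ} (hjk : j ≤ k) : running S k ⊆ running S j :=
  fun _ h i hi => h i (hi.trans_le hjk)

theorem disjoint_declared_running (S : SQHTtest ι) (b : Bool) (k : ℕ) :
    Disjoint (declared S b k) (running S k) := by
  rw [Set.disjoint_left]
  rintro ω ⟨j, hj, -, h⟩ hr
  simp [hr j hj] at h

theorem declared_succ (S : SQHTtest ι) (b : Bool) (k : ℕ) :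
    declared S b (k + 1) = declared S b k ∪ {ω | decidesAt S ω k b} := by
  ext ω
  simp only [declared, Set.mem_ofPred_eq, Set.mem_union, Nat.lt_succ_iff_lt_or_eq, or_and_right,
    exists_or, exists_eq_left]

theorem disjoint_declared_decidesAt (S : SQHTtest ι) (b : Bool) (k : ℕ) :
    Disjoint (declared S b k) {ω | decidesAt S ω k b} :=
  (disjoint_declared_running S b k).mono_right fun _ h => h.1

theorem compl_declared_subset (S : SQHTtest ι) (b : Bool) (k : ℕ) :
    (declared S b k)ᶜ ⊆ declared S (!b) k ∪ running S k := by
  intro ω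
  induction k with
  | zero => exact fun _ => Or.inr fun j hj => absurd hj j.not_lt_zero
  | succ k ih =>
    rw [declared_succ, declared_succ]
    intro h
    rw [Set.mem_compl_iff, Set.mem_union, not_or] at h
    rcases ih h.1 with h1 | h1
    · exact Or.inl (Or.inl h1)
    · rcases hd : S.dec k (pref (k + 1) ω) with _ | c
      · refine Or.inr fun j hj => ?_
        rcases Nat.lt_succ_iff_lt_or_eq.1 hj with hj | rfl
        · exact h1 j hj
        · exact hd
      · have hc : c ≠ b := fun hc => h.2 ⟨h1, hc ▸ hd⟩
        exact Or.inl (Or.inr ⟨h1, by rw [hd]; cases b <;> cases c <;> simp_all⟩)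

/-- The log-likelihood ratio of the observations made before stopping, truncated at `n`. -/
noncomputable def stoppedLogRatio (ρ σ : Mat ι) (S : SQHTtest ι) (n : ℕ) (ω : Traj ι S.N) : ℝ :=
  ∑ j ∈ Finset.range n, (running S j).indicator (fun ω => logRatio ρ σ (ω j)) ω

theorem measurable_stoppedLogRatio (ρ σ : Mat ι) (S : SQHTtest ι) (n : ℕ) :
    Measurable (stoppedLogRatio ρ σ S n) :=
  Finset.measurable_sum _ fun j _ =>
    ((measurable_logRatio ρ σ).comp (measurable_pi_apply j)).indicator
      (past_le _ _ (measurableSet_running S j))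

theorem abs_stoppedLogRatio_le {ρ σ : Mat ι} {S : SQHTtest ι} {K : ℝ} (hK0 : 0 ≤ K)
    (hK : ∀ p : POVM ι S.N × Fin S.N, |logRatio ρ σ p| ≤ K) (n : ℕ) (ω : Traj ι S.N) :
    |stoppedLogRatio ρ σ S n ω| ≤ n * K := by
  calc _ ≤ ∑ j ∈ Finset.range n,
        |(running S j).indicator (fun ω => logRatio ρ σ (ω j)) ω| := Finset.abs_sum_le_sum_abs _ _
    _ ≤ ∑ _j ∈ Finset.range n, K := Finset.sum_le_sum fun j _ => by
        by_cases h : ω ∈ running S j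
        · simpa [h] using hK _
        · simpa [h] using hK0
    _ = n * K := by simp

theorem exp_neg_stoppedLogRatio_of_running {ρ σ : Mat ι} {S : SQHTtest ι} {n : ℕ} {ω : Traj ι S.N}
    (h : ω ∈ running S n) : ENNReal.ofReal (Real.exp (-stoppedLogRatio ρ σ S (n + 1) ω)) =
      ∏ j ∈ Finset.range (n + 1), likRatio ρ σ (ω j) := by
  have : stoppedLogRatio ρ σ S (n + 1) ω = ∑ j ∈ Finset.range (n + 1), logRatio ρ σ (ω j) :=
    Finset.sum_congr rfl fun j hj => Set.indicator_of_mem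
      (running_anti S (Nat.lt_succ_iff.1 (Finset.mem_range.1 hj)) h) _
  rw [this, ← Finset.sum_neg_distrib, Real.exp_sum,
    ENNReal.ofReal_prod_of_nonneg fun _ _ => (Real.exp_pos _).le]
  rfl

theorem setLIntegral_prod_likRatio_le {ρ σ : Mat ι} (hρ : ρ.PosDef) (hσ : σ.PosDef)
    {S : SQHTtest ι} {P Q : Measure (Traj ι S.N)} (hP : IsLaw ρ S P) (hQ : IsLaw σ S Q) (n : ℕ)
    {E : Set (Traj ι S.N)} (hE : MeasurableSet[past ι S.N n] E) :
    ∫⁻ ω in E, ∏ j ∈ Finset.range n, likRatio ρ σ (ω j) ∂P ≤ Q E := by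
  obtain ⟨s, hs, rfl⟩ := hE
  have hL : Measurable fun h : Hist ι S.N n => ∏ j, likRatio ρ σ (h j) :=
    Finset.measurable_prod _ fun j _ => (measurable_likRatio ρ σ).comp (measurable_pi_apply j)
  have key := lintegral_prod_likRatio_mul_le hρ hσ S.μ S.markov n (measurable_one.indicator hs)
  rw [lintegral_indicator_one hs, ← hQ.2 n, Measure.map_apply (measurable_pref n) hs,
    ← hP.2 n, lintegral_map (f := fun h => (∏ j, likRatio ρ σ (h j)) * s.indicator 1 h)
      (hL.mul (measurable_one.indicator hs)) (measurable_pref n)] at key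
  refine le_trans (le_of_eq ?_) key
  rw [← lintegral_indicator (measurable_pref n hs)]
  refine lintegral_congr fun ω => ?_
  by_cases h : pref n ω ∈ s
  · rw [Set.indicator_of_mem (show ω ∈ pref n ⁻¹' s from h), Set.indicator_of_mem h,
      Pi.one_apply, mul_one, Finset.prod_range]
    rfl
  · rw [Set.indicator_of_notMem (show ω ∉ pref n ⁻¹' s from h), Set.indicator_of_notMem h, mul_zero]

theorem setLIntegral_running_le {ρ σ : Mat ι} (hρ : ρ.PosDef) (hσ : σ.PosDef)
    {S : SQHTtest ι} {P Q : Measure (Traj ι S.N)} (hP : IsLaw ρ S P) (hQ : IsLaw σ S Q) (n : ℕ) :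
    ∫⁻ ω in running S n, ENNReal.ofReal (Real.exp (-stoppedLogRatio ρ σ S n ω)) ∂P ≤
      Q (running S n) := by
  refine le_trans (le_of_eq ?_)
    (setLIntegral_prod_likRatio_le hρ hσ hP hQ n (measurableSet_running S n))
  refine setLIntegral_congr_fun (past_le _ _ (measurableSet_running S n)) fun ω hω => ?_
  cases n with
  | zero => simp [stoppedLogRatio]
  | succ n => exact exp_neg_stoppedLogRatio_of_running (running_anti S n.le_succ hω)

theorem setLIntegral_declared_le {ρ σ : Mat ι} (hρ : ρ.PosDef) (hσ : σ.PosDef)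
    {S : SQHTtest ι} {P Q : Measure (Traj ι S.N)} (hP : IsLaw ρ S P) (hQ : IsLaw σ S Q)
    (b : Bool) (n : ℕ) :
    ∫⁻ ω in declared S b n, ENNReal.ofReal (Real.exp (-stoppedLogRatio ρ σ S n ω)) ∂P ≤
      Q (declared S b n) := by
  induction n with
  | zero => simp [declared]
  | succ n ih =>
    have hD := measurableSet_decidesAt S n b
    have hD' : MeasurableSet {ω : Traj ι S.N | decidesAt S ω n b} := past_le _ _ hD
    rw [declared_succ, lintegral_union hD' (disjoint_declared_decidesAt S b n),
      measure_union (disjoint_declared_decidesAt S b n) hD']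
    refine add_le_add (le_trans (le_of_eq ?_) ih) (le_trans (le_of_eq ?_)
      (setLIntegral_prod_likRatio_le hρ hσ hP hQ (n + 1) hD))
    · refine setLIntegral_congr_fun (measurableSet_declared S b n) fun ω hω => ?_
      have : ω ∉ running S n := fun h =>
        Set.disjoint_left.1 (disjoint_declared_running S b n) hω h
      simp only [stoppedLogRatio, Finset.sum_range_succ, Set.indicator_of_notMem this, add_zero]
    · exact setLIntegral_congr_fun hD' fun ω hω => exp_neg_stoppedLogRatio_of_running hω.1

theorem setLIntegral_compl_declared_le {ρ σ : Mat ι} (hρ : ρ.PosDef) (hσ : σ.PosDef)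
    {S : SQHTtest ι} {P Q : Measure (Traj ι S.N)} (hP : IsLaw ρ S P) (hQ : IsLaw σ S Q)
    (b : Bool) (n : ℕ) :
    ∫⁻ ω in (declared S b n)ᶜ, ENNReal.ofReal (Real.exp (-stoppedLogRatio ρ σ S n ω)) ∂P ≤ 1 := by
  have := hQ.1
  have hR : MeasurableSet (running S n) := past_le _ _ (measurableSet_running S n)
  refine (lintegral_mono_set (compl_declared_subset S b n)).trans ?_
  rw [lintegral_union hR (disjoint_declared_running S (!b) n)]
  refine (add_le_add (setLIntegral_declared_le hρ hσ hP hQ (!b) n)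
    (setLIntegral_running_le hρ hσ hP hQ n)).trans ?_
  rw [← measure_union (disjoint_declared_running S (!b) n) hR]
  exact prob_le_one

/-- One-step drift: each observation contributes at most the measured relative entropy. -/
theorem setIntegral_logRatio_le {ρ σ : Mat ι} (hρ : IsState ρ) (hσ : IsState σ) (hρ' : ρ.PosDef)
    (hσ' : σ.PosDef) {S : SQHTtest ι} {P : Measure (Traj ι S.N)} (hP : IsLaw ρ S P) (k : ℕ) :
    ∫ ω in running S k, logRatio ρ σ (ω k) ∂P ≤ Dmeas ρ σ * P.real (running S k) := by
  have := hP.1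
  have := S.markov k
  obtain ⟨K, hK0, hK⟩ := exists_abs_logRatio_le hρ' hσ'
  have hD0 := Dmeas_nonneg hρ hσ hρ' hσ'
  have hR : MeasurableSet (running S k) := past_le _ _ (measurableSet_running S k)
  obtain ⟨s, hs, hsR⟩ := measurableSet_running S k
  have hmeas : Measurable fun ω : Traj ι S.N => logRatio ρ σ (ω k) :=
    (measurable_logRatio ρ σ).comp (measurable_pi_apply k)
  have hnn : ∀ p : POVM ι S.N × Fin S.N, 0 ≤ logRatio ρ σ p + K := fun p => by
    linarith [(abs_le.1 (hK p)).1]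
  have hF : Measurable fun h : Hist ι S.N (k + 1) =>
      s.indicator 1 (fun i : Fin k => h i.castSucc) *
        ENNReal.ofReal (logRatio ρ σ (h (Fin.last k)) + K) := by
    refine Measurable.mul ((measurable_one.indicator hs).comp
      (measurable_pi_iff.2 fun i => measurable_pi_apply _)) ?_
    exact (((measurable_logRatio ρ σ).comp (measurable_pi_apply _)).add_const K).ennreal_ofReal
  have hone : ∀ m : POVM ι S.N, ∑ x, ENNReal.ofReal (outProb ρ m.1 x) *
      ENNReal.ofReal (logRatio ρ σ (m, x) + K) ≤ ENNReal.ofReal (Dmeas ρ σ + K) := by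
    intro m
    have hp := fun x => outProb_nonneg hρ.1 (m.2.1 x)
    simp only [← ENNReal.ofReal_mul (hp _)]
    rw [← ENNReal.ofReal_sum_of_nonneg fun x _ => mul_nonneg (hp x) (hnn _)]
    refine ENNReal.ofReal_le_ofReal ?_
    simp only [mul_add, Finset.sum_add_distrib, ← Finset.sum_mul, sum_outProb hρ.2 m.2.2, one_mul]
    refine add_le_add_left (le_trans (le_of_eq ?_) (KL_le_Dmeas hρ hσ hρ' hσ' m.2.1 m.2.2)) _
    refine Finset.sum_congr rfl fun x _ => ?_
    split_ifs with h
    · rw [h, zero_mul]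
    · rfl
  have hlint : ∫⁻ ω in running S k, ENNReal.ofReal (logRatio ρ σ (ω k) + K) ∂P ≤
      ENNReal.ofReal (Dmeas ρ σ + K) * P (running S k) := by
    calc _ = ∫⁻ ω, s.indicator 1 (pref k ω) * ENNReal.ofReal (logRatio ρ σ (ω k) + K) ∂P := by
          rw [← lintegral_indicator hR]
          refine lintegral_congr fun ω => ?_
          have hiff : ω ∈ running S k ↔ pref k ω ∈ s := by rw [← hsR]; rfl
          by_cases h : pref k ω ∈ s
          · rw [Set.indicator_of_mem (hiff.2 h), Set.indicator_of_mem h, Pi.one_apply, one_mul]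
          · rw [Set.indicator_of_notMem (mt hiff.1 h), Set.indicator_of_notMem h, zero_mul]
      _ = ∫⁻ h, s.indicator 1 (fun i : Fin k => h i.castSucc) *
            ENNReal.ofReal (logRatio ρ σ (h (Fin.last k)) + K) ∂(stepLaw ρ S.μ (k + 1)) := by
          rw [← hP.2 (k + 1), lintegral_map hF (measurable_pref _)]
          rfl
      _ ≤ ∫⁻ h, s.indicator 1 h * ENNReal.ofReal (Dmeas ρ σ + K) ∂(stepLaw ρ S.μ k) := by
          rw [lintegral_stepLaw_succ ρ S.μ S.markov k hF]
          refine lintegral_mono fun h => ?_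
          simp only [Fin.snoc_castSucc, Fin.snoc_last]
          calc _ ≤ ∫⁻ _m, s.indicator 1 h * ENNReal.ofReal (Dmeas ρ σ + K) ∂(S.μ k h) := by
                refine lintegral_mono fun m => ?_
                simp only [mul_left_comm _ (s.indicator 1 h : ℝ≥0∞)]
                rw [← Finset.mul_sum]
                exact mul_le_mul_right (hone m) _
            _ = _ := by rw [lintegral_const, measure_univ, mul_one]
      _ = _ := by
          rw [lintegral_mul_const _ (measurable_one.indicator hs), lintegral_indicator_one hs,
            ← hP.2 k, Measure.map_apply (measurable_pref k) hs, hsR, mul_comm]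
  have hint : IntegrableOn (fun ω : Traj ι S.N => logRatio ρ σ (ω k)) (running S k) P :=
    Integrable.of_bound hmeas.aestronglyMeasurable K (ae_of_all _ fun ω => hK _)
  have hreal : ∫ ω in running S k, (logRatio ρ σ (ω k) + K) ∂P ≤
      (Dmeas ρ σ + K) * P.real (running S k) := by
    rw [integral_eq_lintegral_of_nonneg_ae (ae_of_all _ fun ω => hnn _)
      (hmeas.add_const K).aestronglyMeasurable]
    refine (ENNReal.toReal_mono (by finiteness) hlint).trans (le_of_eq ?_)
    rw [ENNReal.toReal_mul, ENNReal.toReal_ofReal (by positivity)]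
    rfl
  rw [integral_add hint (integrable_const K), setIntegral_const, smul_eq_mul] at hreal
  linarith

theorem sum_indicator_running_le_stopTime (S : SQHTtest ι) (n : ℕ) (ω : Traj ι S.N) :
    ∑ j ∈ Finset.range n, (running S j).indicator (1 : Traj ι S.N → ℝ≥0∞) ω ≤ stopTime S ω := by
  refine le_sInf ?_
  rintro _ ⟨k, rfl, hk⟩
  calc _ ≤ ∑ j ∈ Finset.range n, if j ∈ Finset.range (k + 1) then (1 : ℝ≥0∞) else 0 := by
        refine Finset.sum_le_sum fun j _ => ?_
        by_cases hj : ω ∈ running S j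
        · have : j < k + 1 := by
            by_contra h
            exact hk (hj k (by omega))
          simp [hj, this]
        · simp [hj]
    _ ≤ ((k + 1 : ℕ) : ℝ≥0∞) := by
        rw [← Finset.sum_filter, Finset.sum_const, nsmul_one]
        exact_mod_cast (Finset.card_le_card fun j hj => (Finset.mem_filter.1 hj).2).trans
          (Finset.card_range _).le
    _ = _ := by push_cast; rfl

theorem sum_measure_running_le {S : SQHTtest ι} {P : Measure (Traj ι S.N)}
    [IsProbabilityMeasure P] (hT : expT S P ≠ ⊤) (n : ℕ) :
    ∑ j ∈ Finset.range n, P.real (running S j) ≤ (expT S P).toReal := by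
  have hR : ∀ j, MeasurableSet (running S j) := fun j => past_le _ _ (measurableSet_running S j)
  have : ∑ j ∈ Finset.range n, P (running S j) ≤ expT S P := by
    calc _ = ∫⁻ ω, ∑ j ∈ Finset.range n, (running S j).indicator 1 ω ∂P := by
          rw [lintegral_finsetSum _ fun j _ => measurable_one.indicator (hR j)]
          simp only [lintegral_indicator_one (hR _)]
      _ ≤ _ := lintegral_mono fun ω => sum_indicator_running_le_stopTime S n ω
  have hle := ENNReal.toReal_mono hT this
  rwa [ENNReal.toReal_sum fun _ _ => measure_ne_top _ _] at hle

/-- Wald-type bound on the expected stopped log-likelihood ratio. -/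
theorem integral_stoppedLogRatio_le {ρ σ : Mat ι} (hρ : IsState ρ) (hσ : IsState σ)
    (hρ' : ρ.PosDef) (hσ' : σ.PosDef) {S : SQHTtest ι} {P : Measure (Traj ι S.N)}
    (hP : IsLaw ρ S P) (hT : expT S P ≠ ⊤) (n : ℕ) :
    ∫ ω, stoppedLogRatio ρ σ S n ω ∂P ≤ (expT S P).toReal * Dmeas ρ σ := by
  have := hP.1
  obtain ⟨K, hK0, hK⟩ := exists_abs_logRatio_le hρ' hσ'
  have hR : ∀ j, MeasurableSet (running S j) := fun j => past_le _ _ (measurableSet_running S j)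
  have hint : ∀ j, Integrable (fun ω : Traj ι S.N => logRatio ρ σ (ω j)) P := fun j =>
    Integrable.of_bound ((measurable_logRatio ρ σ).comp
      (measurable_pi_apply j)).aestronglyMeasurable K (ae_of_all _ fun ω => hK _)
  simp only [stoppedLogRatio]
  rw [integral_finsetSum _ fun j _ => (hint j).indicator (hR j)]
  simp only [integral_indicator (hR _)]
  calc _ ≤ ∑ j ∈ Finset.range n, Dmeas ρ σ * P.real (running S j) :=
        Finset.sum_le_sum fun j _ => setIntegral_logRatio_le hρ hσ hρ' hσ' hP j
    _ = (∑ j ∈ Finset.range n, P.real (running S j)) * Dmeas ρ σ := by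
        rw [← Finset.mul_sum, mul_comm]
    _ ≤ _ := by
        have hD := Dmeas_nonneg hρ hσ hρ' hσ'
        gcongr
        exact sum_measure_running_le hT n

/-- Tangent-line lower bound on the expected stopped log-likelihood ratio over an event. -/
theorem le_setIntegral_of_exp {Ω : Type*} [MeasurableSpace Ω] {P : Measure Ω}
    [IsProbabilityMeasure P] {Y : Ω → ℝ} (hY : Measurable Y) {M : ℝ} (hM : ∀ ω, |Y ω| ≤ M)
    (E : Set Ω) {q : ℝ} (hq : 0 < q)
    (h : ∫⁻ ω in E, ENNReal.ofReal (Real.exp (-Y ω)) ∂P ≤ ENNReal.ofReal q) :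
    (1 + Real.log (1 / q)) * P.real E - 1 ≤ ∫ ω in E, Y ω ∂P := by
  have hYint : IntegrableOn Y E P :=
    Integrable.of_bound hY.aestronglyMeasurable M (ae_of_all _ hM)
  have hexpm : Measurable fun ω => Real.exp (-Y ω) := hY.neg.exp
  have hexpint : IntegrableOn (fun ω => Real.exp (-Y ω)) E P :=
    Integrable.of_bound hexpm.aestronglyMeasurable (Real.exp M) (ae_of_all _ fun ω => by
      rw [Real.norm_of_nonneg (Real.exp_pos _).le]
      exact Real.exp_le_exp.2 (by linarith [(abs_le.1 (hM ω)).1]))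
  have hexp : ∫ ω in E, Real.exp (-Y ω) ∂P ≤ q := by
    rw [integral_eq_lintegral_of_nonneg_ae (ae_of_all _ fun ω => (Real.exp_pos _).le)
      hexpm.aestronglyMeasurable]
    exact ENNReal.toReal_le_of_le_ofReal hq.le h
  have hpt : ∀ ω, (1 + Real.log (1 / q)) - q⁻¹ * Real.exp (-Y ω) ≤ Y ω := by
    intro ω
    have := Real.add_one_le_exp (Real.log (1 / q) - Y ω)
    rw [sub_eq_add_neg, Real.exp_add, Real.exp_log (by positivity), one_div] at this
    rw [one_div]
    linarith
  have hmono : ∫ ω in E, ((1 + Real.log (1 / q)) - q⁻¹ * Real.exp (-Y ω)) ∂P ≤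
      ∫ ω in E, Y ω ∂P :=
    integral_mono ((integrable_const _).sub (hexpint.const_mul _)) hYint hpt
  rw [integral_sub (integrable_const _) (hexpint.const_mul _), setIntegral_const,
    integral_const_mul, smul_eq_mul] at hmono
  have : q⁻¹ * ∫ ω in E, Real.exp (-Y ω) ∂P ≤ 1 := by
    rw [inv_mul_le_iff₀ hq, mul_one]
    exact hexp
  linarith

/-- Probability of ever declaring `b`. -/
noncomputable def declareProb (S : SQHTtest ι) (P : Measure (Traj ι S.N)) (b : Bool) : ℝ≥0∞ :=
  P {ω | ∃ k, decidesAt S ω k b}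

theorem iUnion_declared (S : SQHTtest ι) (b : Bool) :
    ⋃ n, declared S b n = {ω | ∃ k, decidesAt S ω k b} := by
  ext ω
  simp only [declared, Set.mem_iUnion, Set.mem_ofPred_eq]
  exact ⟨fun ⟨_, k, _, h⟩ => ⟨k, h⟩, fun ⟨k, h⟩ => ⟨k + 1, k, k.lt_succ_self, h⟩⟩

theorem declared_mono (S : SQHTtest ι) (b : Bool) : Monotone (declared S b) :=
  fun _ _ hmn _ ⟨j, hj, h⟩ => ⟨j, hj.trans_le hmn, h⟩

theorem one_le_declareProb_add {S : SQHTtest ι} {P : Measure (Traj ι S.N)}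
    [IsProbabilityMeasure P] (hT : expT S P ≠ ⊤) (b : Bool) :
    1 ≤ declareProb S P b + declareProb S P (!b) := by
  have hnever : P {ω | ∀ k, S.dec k (pref (k + 1) ω) = none} = 0 := by
    have hm : MeasurableSet {ω : Traj ι S.N | ∀ k, S.dec k (pref (k + 1) ω) = none} := by
      rw [Set.ofPred_forall]
      exact MeasurableSet.iInter fun k => past_le _ _ (measurableSet_dec S k none)
    by_contra h
    refine hT (top_le_iff.1 ?_)
    calc ⊤ = ∫⁻ _ω in {ω | ∀ k, S.dec k (pref (k + 1) ω) = none}, ⊤ ∂P := by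
          rw [setLIntegral_const, ENNReal.top_mul h]
      _ ≤ ∫⁻ ω in {ω | ∀ k, S.dec k (pref (k + 1) ω) = none}, stopTime S ω ∂P := by
          refine setLIntegral_mono' hm fun ω hω => le_sInf ?_
          rintro _ ⟨k, -, hk⟩
          exact absurd (hω k) hk
      _ ≤ _ := setLIntegral_le_lintegral _ _
  have hcover : (Set.univ : Set (Traj ι S.N)) ⊆ ({ω | ∃ k, decidesAt S ω k b} ∪
      {ω | ∃ k, decidesAt S ω k (!b)}) ∪ {ω | ∀ k, S.dec k (pref (k + 1) ω) = none} := by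
    intro ω _
    by_cases h : ∀ k, S.dec k (pref (k + 1) ω) = none
    · exact Or.inr h
    · refine Or.inl ?_
      push Not at h
      classical
      have hlt : ∀ j, j < Nat.find h → S.dec j (pref (j + 1) ω) = none := fun j hj => by
        simpa using Nat.find_min h hj
      obtain ⟨c, hc⟩ := Option.ne_none_iff_exists'.1 (Nat.find_spec h)
      by_cases hcb : c = b
      · exact Or.inl ⟨_, hlt, hcb ▸ hc⟩
      · have hcb' : c = !b := by cases b <;> cases c <;> simp_all
        exact Or.inr ⟨_, hlt, hcb' ▸ hc⟩
  calc 1 = P Set.univ := measure_univ.symm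
    _ ≤ _ := measure_mono hcover
    _ ≤ _ := measure_union_le _ _
    _ ≤ _ := by rw [hnever, add_zero]; exact measure_union_le _ _

theorem log_one_div_declareProb_le {ρ σ : Mat ι} (hρ : IsState ρ) (hσ : IsState σ)
    (hρ' : ρ.PosDef) (hσ' : σ.PosDef) {S : SQHTtest ι} {P Q : Measure (Traj ι S.N)}
    (hP : IsLaw ρ S P) (hQ : IsLaw σ S Q) (hT : expT S P ≠ ⊤) (b : Bool)
    (hlt : declareProb S P (!b) < 1) :
    Real.log (1 / (declareProb S Q b).toReal) ≤
      ((expT S P).toReal * Dmeas ρ σ + 1) / (1 - (declareProb S P (!b)).toReal) := by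
  have := hP.1
  have := hQ.1
  have hα : (declareProb S P (!b)).toReal < 1 := by
    rw [← ENNReal.toReal_one]
    exact ENNReal.toReal_strict_mono ENNReal.one_ne_top hlt
  have hPtop : ∀ c, declareProb S P c ≠ ⊤ := fun _ => measure_ne_top P _
  have hQtop : declareProb S Q b ≠ ⊤ := measure_ne_top Q _
  have hD := Dmeas_nonneg hρ hσ hρ' hσ'
  rw [le_div_iff₀ (sub_pos.2 hα)]
  set q := (declareProb S Q b).toReal with hq
  have hq0 : 0 ≤ q := ENNReal.toReal_nonneg
  rcases hq0.eq_or_lt with h0 | hqpos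
  · rw [← h0]
    simp only [div_zero, Real.log_zero, zero_mul]
    positivity
  have hq1 : q ≤ 1 := measureReal_le_one
  have hs : 0 ≤ Real.log (1 / q) := Real.log_nonneg ((one_le_div hqpos).2 hq1)
  obtain ⟨K, hK0, hK⟩ := exists_abs_logRatio_le hρ' hσ'
  have hbound : ∀ n, Real.log (1 / q) * P.real (declared S b n) ≤
      (expT S P).toReal * Dmeas ρ σ + 1 := by
    intro n
    have hY := measurable_stoppedLogRatio ρ σ S n
    have hM := abs_stoppedLogRatio_le (ρ := ρ) (σ := σ) (S := S) hK0 hK n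
    have hA := measurableSet_declared S b n
    have h1 := le_setIntegral_of_exp (P := P) hY hM (declared S b n) hqpos (by
      refine (setLIntegral_declared_le hρ' hσ' hP hQ b n).trans ?_
      rw [hq, ENNReal.ofReal_toReal hQtop]
      exact measure_mono fun ω ⟨k, _, h⟩ => ⟨k, h⟩)
    have h2 := le_setIntegral_of_exp (P := P) hY hM (declared S b n)ᶜ one_pos (by
      rw [ENNReal.ofReal_one]
      exact setLIntegral_compl_declared_le hρ' hσ' hP hQ b n)
    have hint : Integrable (stoppedLogRatio ρ σ S n) P :=
      Integrable.of_bound hY.aestronglyMeasurable _ (ae_of_all _ hM)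
    have h3 := integral_add_compl hA hint
    have h4 := integral_stoppedLogRatio_le hρ hσ hρ' hσ' hP hT n
    have h5 := probReal_add_probReal_compl (μ := P) hA
    simp only [div_one, Real.log_one, add_zero, one_mul] at h2
    linarith
  have hlim : Tendsto (fun n => Real.log (1 / q) * P.real (declared S b n)) atTop
      (𝓝 (Real.log (1 / q) * (declareProb S P b).toReal)) := by
    refine Tendsto.const_mul _ ?_
    refine (ENNReal.tendsto_toReal (hPtop b)).comp ?_
    rw [declareProb, ← iUnion_declared]
    exact tendsto_measure_iUnion_atTop (declared_mono S b)
  refine le_trans (mul_le_mul_of_nonneg_left ?_ hs) (le_of_tendsto' hlim hbound)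
  have hge := ENNReal.toReal_mono (ENNReal.add_ne_top.2 ⟨hPtop b, hPtop _⟩)
    (one_le_declareProb_add (P := P) hT b)
  rw [ENNReal.toReal_add (hPtop _) (hPtop _), ENNReal.toReal_one] at hge
  linarith

/-- Lemma 14 in the paper: for any SQHT with
`max_i E_i[T] < ∞` and error probabilities `α < 1`, `β < 1`,
`log(1/β) ≤ (E_0[T]·D_M(ρ0‖ρ1) + 1)/(1 − α)` and
`log(1/α) ≤ (E_1[T]·D_M(ρ1‖ρ0) + 1)/(1 − β)`. -/
theorem converse_error_probability_bounds
    (d : ℕ) (hd : 0 < d) (ρ0 ρ1 : Mat (Fin d))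
    (h0 : IsState ρ0) (h1 : IsState ρ1)
    (hfs0 : ρ0.PosDef) (hfs1 : ρ1.PosDef)
    (S : SQHTtest (Fin d)) (P0 P1 : Measure (Traj (Fin d) S.N))
    (hP0 : IsLaw ρ0 S P0) (hP1 : IsLaw ρ1 S P1)
    (hT0 : expT S P0 ≠ ⊤) (hT1 : expT S P1 ≠ ⊤)
    (hα : errA S P0 < 1) (hβ : errB S P1 < 1) :
    Real.log (1 / (errB S P1).toReal) ≤
      ((expT S P0).toReal * Dmeas ρ0 ρ1 + 1) / (1 - (errA S P0).toReal) ∧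
    Real.log (1 / (errA S P0).toReal) ≤
      ((expT S P1).toReal * Dmeas ρ1 ρ0 + 1) / (1 - (errB S P1).toReal) :=
  ⟨log_one_div_declareProb_le h0 h1 hfs0 hfs1 hP0 hP1 hT0 false hα,
    log_one_div_declareProb_le h1 h0 hfs1 hfs0 hP1 hP0 hT1 true hβ⟩

end SQHT
end
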